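/- arXiv:1210.0480 — 3 statements merged into one kernel-verified Lean document; each statement's English description precedes it below -/
import Mathlib

section
/- For every real number x with 0 ≤ x ≤ 1/2, the infinite product ∏_{i=1}^∞ (1 − x^i)^{−1} converges and satisfies ∏_{i=1}^∞ (1 − x^i)^{−1} ≤ 1 + 5x. Consequently, the sum of x^{|λ|} over all nonempty integer partitions λ is at most 5x. -/
open Finset in
theorem aux_half (k : ℕ) :
    (2/7 : ℝ) * (1 + 2 * (1/2)^(k+7)) ≤ ∏ i ∈ range (k+7), (1 - (1/2 : ℝ)^(i+1)) := by
  induction k with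
  | zero => norm_num [Finset.prod_range_succ]
  | succ k ih =>
    rw [show k + 1 + 7 = (k + 7) + 1 by ring, Finset.prod_range_succ]
    have h0 : (0:ℝ) < (1/2)^(k+7) := by positivity
    have h1 : ((1:ℝ)/2)^(k+7) ≤ 1/2 := by
      calc ((1:ℝ)/2)^(k+7) ≤ (1/2)^1 := pow_le_pow_of_le_one (by norm_num) (by norm_num) (by omega)
        _ = 1/2 := by norm_num
    rw [pow_succ (1/2 : ℝ) (k+7)]
    set t : ℝ := (1/2)^(k+7)
    have := mul_le_mul_of_nonneg_right ih (show 0 ≤ 1 - t * (1/2) by linarith)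
    nlinarith

theorem aux_one_sub_pos (i : ℕ) (x : ℝ) (hx0 : 0 ≤ x) (hx1 : x ≤ 1 / 2) :
    x ^ (i+1) ≤ 2 * x * (1/2)^(i+1) ∧ x^(i+1) ≤ (1/2)^(i+1) ∧ ((1:ℝ)/2)^(i+1) ≤ 1/2 ∧
      0 ≤ x^(i+1) := by
  have h1 : x ^ i ≤ (1/2)^i := pow_le_pow_left₀ hx0 hx1 i
  have h2 : ((1:ℝ)/2)^i ≤ 1 := pow_le_one₀ (by norm_num) (by norm_num)
  refine ⟨?_, pow_le_pow_left₀ hx0 hx1 _, ?_, by positivity⟩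
  · rw [pow_succ, pow_succ]; nlinarith
  · rw [pow_succ]; linarith

open Finset in
theorem aux_star (N : ℕ) (x : ℝ) (hx0 : 0 ≤ x) (hx1 : x ≤ 1 / 2) :
    1 ≤ ∏ i ∈ range N, (1 - x^(i+1))⁻¹ ∧
    ∏ i ∈ range N, (1 - x^(i+1))⁻¹ ≤ ∏ i ∈ range N, (1 - (1/2 : ℝ)^(i+1))⁻¹ ∧
    ∏ i ∈ range N, (1 - x^(i+1))⁻¹ - 1 ≤
      2 * x * (∏ i ∈ range N, (1 - (1/2 : ℝ)^(i+1))⁻¹ - 1) := by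
  induction N with
  | zero => simp
  | succ N ih =>
    obtain ⟨a1, a2, a3⟩ := ih
    obtain ⟨b1, b2, b3, b4⟩ := aux_one_sub_pos N x hx0 hx1
    simp only [Finset.prod_range_succ]
    set f := ∏ i ∈ range N, (1 - x^(i+1))⁻¹
    set F := ∏ i ∈ range N, (1 - (1/2 : ℝ)^(i+1))⁻¹
    set y := x^(N+1)
    set z := ((1:ℝ)/2)^(N+1)
    have g1 : 1 ≤ (1-y)⁻¹ := (one_le_inv₀ (by linarith)).2 (by linarith)
    have g2 : (1-y)⁻¹ ≤ (1-z)⁻¹ := inv_anti₀ (by linarith) (by linarith)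
    have e1 : (1-y)⁻¹ - 1 = y * (1-y)⁻¹ := by
      have : 1 - y ≠ 0 := by linarith
      field_simp; ring
    have e2 : (1-z)⁻¹ - 1 = z * (1-z)⁻¹ := by
      have : 1 - z ≠ 0 := by linarith
      field_simp; ring
    have g3 : (1-y)⁻¹ - 1 ≤ 2 * x * ((1-z)⁻¹ - 1) := by
      rw [e1, e2, ← mul_assoc]
      exact mul_le_mul b1 g2 (by linarith) (by linarith)
    set g := (1-y)⁻¹
    set G := (1-z)⁻¹
    refine ⟨by nlinarith, mul_le_mul a2 g2 (by linarith) (by linarith), ?_⟩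
    have : (f - 1) * g ≤ (2 * x * (F - 1)) * G :=
      mul_le_mul a3 g2 (by linarith) (by nlinarith)
    nlinarith

open Finset in
theorem aux_prod_le (N : ℕ) (x : ℝ) (hx0 : 0 ≤ x) (hx1 : x ≤ 1 / 2) :
    ∏ i ∈ range N, (1 - x^(i+1))⁻¹ ≤ 1 + 5 * x := by
  have hF : ∏ i ∈ range (N+7), (1 - (1/2 : ℝ)^(i+1))⁻¹ ≤ 7/2 := by
    rw [Finset.prod_inv_distrib]
    have h := aux_half N
    have h0 : (0:ℝ) < (1/2)^(N+7) := by positivity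
    calc _ ≤ (2/7 : ℝ)⁻¹ := inv_anti₀ (by norm_num) (by linarith)
      _ = 7/2 := by norm_num
  have hm : ∏ i ∈ range N, (1 - x^(i+1))⁻¹ ≤ ∏ i ∈ range (N+7), (1 - x^(i+1))⁻¹ := by
    have pos : ∀ i, 1 ≤ (1 - x^(i+1))⁻¹ := fun i => by
      obtain ⟨b1, b2, b3, b4⟩ := aux_one_sub_pos i x hx0 hx1
      exact (one_le_inv₀ (by linarith)).2 (by linarith)
    have mono : Monotone (fun M => ∏ i ∈ range M, (1 - x^(i+1))⁻¹) := by
      apply monotone_nat_of_le_succ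
      intro M
      rw [Finset.prod_range_succ]
      exact le_mul_of_one_le_right (by linarith [(aux_star M x hx0 hx1).1]) (pos M)
    exact mono (by omega)
  obtain ⟨-, -, h⟩ := aux_star (N+7) x hx0 hx1
  nlinarith

theorem aux_size (N n : ℕ) (p : Nat.Partition n) (hn : n ≤ N) :
    ∑ i : Fin N, (p.parts.count (i.1+1)) * (i.1+1) = n := by
  rw [Fin.sum_univ_eq_sum_range (fun i => p.parts.count (i+1) * (i+1)) N]
  conv_rhs => rw [← p.parts_sum, Finset.sum_multiset_count]
  have h : ∑ m ∈ Finset.range (N+1), p.parts.count m * m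
      = ∑ i ∈ Finset.range N, p.parts.count (i+1) * (i+1) := by
    rw [Finset.sum_range_succ']; simp
  rw [← h]
  symm
  simp only [smul_eq_mul]
  apply Finset.sum_subset
  · intro m hm
    have := p.le_of_mem_parts (Multiset.mem_toFinset.1 hm)
    simp; omega
  · intro m _ hm
    rw [Multiset.count_eq_zero_of_notMem (by simpa using hm), zero_mul]

theorem aux_inj (N n m : ℕ) (p : Nat.Partition n) (q : Nat.Partition m) (hn : n ≤ N) (hm : m ≤ N)
    (h : ∀ i : Fin N, p.parts.count (i.1+1) = q.parts.count (i.1+1)) :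
    (⟨n, p⟩ : Σ n, Nat.Partition n) = ⟨m, q⟩ := by
  have e : n = m := by
    rw [← aux_size N n p hn, ← aux_size N m q hm]
    simp [h]
  subst e
  congr 1
  apply Nat.Partition.ext
  ext a
  by_cases ha : a = 0
  · subst ha
    rw [Multiset.count_eq_zero_of_notMem (fun h => (p.parts_pos h).ne rfl),
      Multiset.count_eq_zero_of_notMem (fun h => (q.parts_pos h).ne rfl)]
  by_cases hb : a ≤ N
  · have := h ⟨a - 1, by omega⟩
    simpa [Nat.sub_add_cancel (Nat.pos_of_ne_zero ha)] using this
  · rw [Multiset.count_eq_zero_of_notMem (fun h => by have := p.le_of_mem_parts h; omega),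
      Multiset.count_eq_zero_of_notMem (fun h => by have := q.le_of_mem_parts h; omega)]

open Finset in
theorem aux_part (N : ℕ) (x : ℝ) (hx0 : 0 ≤ x) (hx1 : x ≤ 1 / 2) :
    ∑ n ∈ range (N+1), (Fintype.card (Nat.Partition n) : ℝ) * x ^ n ≤
      ∏ i ∈ range N, (1 - x^(i+1))⁻¹ := by
  classical
  let S : Finset (Σ n, Nat.Partition n) := (range (N+1)).sigma (fun n => univ)
  let φ : (Σ n, Nat.Partition n) → (Fin N → ℕ) := fun s i => s.2.parts.count (i.1+1)
  have hS : ∀ s ∈ S, s.1 ≤ N := fun s hs => by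
    have := (Finset.mem_sigma.1 hs).1
    simp at this; omega
  have hinj : Set.InjOn φ S := by
    rintro ⟨n, p⟩ hs ⟨m, q⟩ ht h
    exact aux_inj N n m p q (hS _ hs) (hS _ ht) (fun i => congrFun h i)
  calc ∑ n ∈ range (N+1), (Fintype.card (Nat.Partition n) : ℝ) * x ^ n
      = ∑ s ∈ S, x ^ s.1 := by
        rw [Finset.sum_sigma]; simp
    _ = ∑ s ∈ S, ∏ i : Fin N, (x ^ (i.1+1)) ^ (φ s i) := by
        apply Finset.sum_congr rfl
        intro s hs
        conv_lhs => rw [← aux_size N s.1 s.2 (hS s hs)]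
        rw [← Finset.prod_pow_eq_pow_sum]
        apply Finset.prod_congr rfl
        intro i _
        rw [← pow_mul, mul_comm]
    _ = ∑ f ∈ S.image φ, ∏ i : Fin N, (x ^ (i.1+1)) ^ (f i) := by
        rw [Finset.sum_image hinj]
    _ ≤ ∑ f ∈ Fintype.piFinset (fun _ : Fin N => range (N+1)),
          ∏ i : Fin N, (x ^ (i.1+1)) ^ (f i) := by
        apply Finset.sum_le_sum_of_subset_of_nonneg
        · intro f hf
          obtain ⟨s, hs, rfl⟩ := Finset.mem_image.1 hf
          rw [Fintype.mem_piFinset]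
          intro i
          have h1 := aux_size N s.1 s.2 (hS s hs)
          have h2 := Finset.single_le_sum
            (f := fun i : Fin N => s.2.parts.count (i.1+1) * (i.1+1))
            (fun _ _ => Nat.zero_le _) (Finset.mem_univ i)
          have h3 := hS s hs
          have h4 : s.2.parts.count (i.1+1) ≤ s.2.parts.count (i.1+1) * (i.1+1) :=
            Nat.le_mul_of_pos_right _ (by omega)
          simp only [Finset.mem_range, φ]
          omega
        · intro f _ _
          positivity
    _ = ∏ i : Fin N, ∑ j ∈ range (N+1), (x ^ (i.1+1)) ^ j := by
        rw [Finset.prod_univ_sum]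
    _ ≤ ∏ i : Fin N, (1 - x^(i.1+1))⁻¹ := by
        apply Finset.prod_le_prod
        · intro i _; positivity
        · intro i _
          obtain ⟨b1, b2, b3, b4⟩ := aux_one_sub_pos i.1 x hx0 hx1
          rw [← tsum_geometric_of_lt_one b4 (by linarith)]
          exact (summable_geometric_of_lt_one b4 (by linarith)).sum_le_tsum _
            (fun j _ => by positivity)
    _ = _ := Fin.prod_univ_eq_prod_range (fun i => (1 - x^(i+1))⁻¹) N

/-- For every real `x` with `0 ≤ x ≤ 1/2`, the infinite product `∏_{i=1}^∞ (1 - x^i)⁻¹`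
converges and is at most `1 + 5x`; consequently the sum of `x^|λ|` over all nonempty
integer partitions `λ` (i.e. `∑_{n ≥ 1} p(n)·xⁿ`) is at most `5x`. -/
theorem statement0 (x : ℝ) (hx0 : 0 ≤ x) (hx1 : x ≤ 1 / 2) :
    Multipliable (fun i : ℕ => (1 - x ^ (i + 1))⁻¹) ∧
    (∏' i : ℕ, (1 - x ^ (i + 1))⁻¹) ≤ 1 + 5 * x ∧
    Summable (fun n : ℕ => (Fintype.card (Nat.Partition (n + 1)) : ℝ) * x ^ (n + 1)) ∧
    (∑' n : ℕ, (Fintype.card (Nat.Partition (n + 1)) : ℝ) * x ^ (n + 1)) ≤ 5 * x := by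
  have hM : Multipliable (fun i : ℕ => (1 - x ^ (i + 1))⁻¹) := by
    have hs : Summable (fun i : ℕ => (1 - x ^ (i + 1))⁻¹ - 1) := by
      apply Summable.of_nonneg_of_le (f := fun i : ℕ => ((1:ℝ)/2)^i)
      · intro i
        obtain ⟨b1, b2, b3, b4⟩ := aux_one_sub_pos i x hx0 hx1
        linarith [(one_le_inv₀ (show 0 < 1 - x^(i+1) by linarith)).2 (by linarith)]
      · intro i
        obtain ⟨b1, b2, b3, b4⟩ := aux_one_sub_pos i x hx0 hx1
        have hp : 0 < 1 - x^(i+1) := by linarith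
        rw [sub_le_iff_le_add, inv_le_iff_one_le_mul₀ hp]
        have e : ((1:ℝ)/2)^(i+1) = (1/2)^i * (1/2) := pow_succ _ _
        nlinarith
      · exact summable_geometric_of_lt_one (by norm_num) (by norm_num)
    have := Real.multipliable_one_add_of_summable hs
    simpa using this
  have hb : ∀ N, ∑ n ∈ Finset.range N, (Fintype.card (Nat.Partition (n + 1)) : ℝ) * x ^ (n + 1)
      ≤ 5 * x := by
    intro N
    have h1 := aux_part N x hx0 hx1
    have h2 := aux_prod_le N x hx0 hx1
    rw [Finset.sum_range_succ'] at h1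
    have h3 : (Fintype.card (Nat.Partition 0) : ℝ) = 1 := by simp
    rw [h3] at h1
    linarith
  have hnn : ∀ n : ℕ, 0 ≤ (Fintype.card (Nat.Partition (n + 1)) : ℝ) * x ^ (n + 1) :=
    fun n => by positivity
  refine ⟨hM, ?_, summable_of_sum_range_le hnn hb, Real.tsum_le_of_sum_range_le hnn hb⟩
  exact le_of_tendsto' hM.hasProd.tendsto_prod_nat (fun N => aux_prod_le N x hx0 hx1)
end

section
/- Let n ≥ 3 and let λ = (λ_1 ≥ λ_2 ≥ … ≥ λ_n ≥ 0) be an integer partition of length n. Define D^λ = ∏_{1≤i<j≤n} (λ_i−λ_j+j−i)/(j−i) · ∏_{1≤i≤j≤n} (λ_i+λ_j+2n+2−i−j)/(2n+2−i−j) and B_n(λ) = (1/(2n))·∑_{i=1}^n (λ_i² + (2n+2−2i)·λ_i). Then D^λ ≤ (14/3)·n^{B_n(λ)}. (This says that for the compact symplectic group USp(n,ℍ), at the cut-off time t = 2·log n, the quantity D^λ·e^{−(t/2)·B_n(λ)} is bounded by 14/3 uniformly in n and λ.) -/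
open Finset

noncomputable def rowD (n : ℕ) (a : ℕ → ℝ) (i : ℕ) : ℝ :=
  (∏ j ∈ Ico (i+1) n, (a i - a j + (j:ℝ) - (i:ℝ)) / ((j:ℝ) - (i:ℝ))) *
  ∏ j ∈ Ico i n, (a i + a j + (2 * (n:ℝ) - i - j)) / (2 * (n:ℝ) - i - j)

noncomputable def rk (n k : ℕ) (a : ℕ → ℝ) : ℝ :=
  ∏ i ∈ range k, ((a i + (2 * (n:ℝ) + 1 - i - k)) / (a i + ((k:ℝ) - i)) *
    ∏ j ∈ Ico (i+1) k, (a i + a j + (2 * (n:ℝ) - i - j) + 2) / (a i + a j + (2 * (n:ℝ) - i - j)))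

lemma tele1 (x : ℝ) (k n : ℕ) (h : k ≤ n) (hx : 0 < x + k) :
    ∏ j ∈ Ico k n, (x + 1 + (j:ℝ)) / (x + j) = (x + n) / (x + k) := by
  induction n, h using Nat.le_induction with
  | base => simp [hx.ne']
  | succ m hm ih =>
    rw [prod_Ico_succ_top hm, ih]
    have : (k:ℝ) ≤ m := by exact_mod_cast hm
    have h1 : 0 < x + m := by linarith
    push_cast
    field_simp
    ring

lemma tele2 (y : ℝ) (k n : ℕ) (h : k ≤ n) (hy : 0 < y + 1 - n) :
    ∏ j ∈ Ico k n, (y + 1 - (j:ℝ)) / (y - j) = (y + 1 - k) / (y + 1 - n) := by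
  induction n, h using Nat.le_induction with
  | base => simp [hy.ne']
  | succ m hm ih =>
    push_cast at hy
    rw [prod_Ico_succ_top hm, ih (by linarith)]
    have h1 : 0 < y - m := by linarith
    have h2 : 0 < y + 1 - m := by linarith
    push_cast
    have h3 : y + 1 - ((m:ℝ) + 1) = y - m := by ring
    rw [h3]
    field_simp

noncomputable def bump (k : ℕ) (a : ℕ → ℝ) : ℕ → ℝ := fun i => if i < k then a i + 1 else a i

lemma row_ge (n k : ℕ) (a : ℕ → ℝ) (i : ℕ) (hi : k ≤ i) : rowD n (bump k a) i = rowD n a i := by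
  unfold rowD
  congr 1 <;> refine prod_congr rfl fun j hj => ?_ <;> rw [mem_Ico] at hj <;>
    simp [bump, show ¬ i < k by omega, show ¬ j < k by omega]

lemma row_lt (n k : ℕ) (hk : k ≤ n) (a : ℕ → ℝ) (ha : ∀ i, 0 ≤ a i) (h0 : ∀ j, k ≤ j → a j = 0)
    (i : ℕ) (hi : i < k) :
    rowD n (bump k a) i = rowD n a i * ((a i + (2 * (n:ℝ) + 1 - i - k)) / (a i + ((k:ℝ) - i)) *
    ∏ j ∈ Ico (i+1) k, (a i + a j + (2 * (n:ℝ) - i - j) + 2) / (a i + a j + (2 * (n:ℝ) - i - j))) := by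
  have hin : i < n := by omega
  have hik' : (i:ℝ) + 1 ≤ k := by exact_mod_cast hi
  have hkn' : (k:ℝ) ≤ n := by exact_mod_cast hk
  have hai := ha i
  have A1 : ∏ j ∈ Ico (i+1) k, (bump k a i - bump k a j + (j:ℝ) - (i:ℝ)) / ((j:ℝ) - (i:ℝ)) =
      ∏ j ∈ Ico (i+1) k, (a i - a j + (j:ℝ) - (i:ℝ)) / ((j:ℝ) - (i:ℝ)) := by
    refine prod_congr rfl fun j hj => ?_
    rw [mem_Ico] at hj
    simp [bump, hi, hj.2]
  have A2 : ∏ j ∈ Ico k n, (bump k a i - bump k a j + (j:ℝ) - (i:ℝ)) / ((j:ℝ) - (i:ℝ)) =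
      (∏ j ∈ Ico k n, (a i - a j + (j:ℝ) - (i:ℝ)) / ((j:ℝ) - (i:ℝ))) *
        ((a i - i + n) / (a i - i + k)) := by
    rw [← tele1 (a i - i) k n hk (by linarith), ← prod_mul_distrib]
    refine prod_congr rfl fun j hj => ?_
    rw [mem_Ico] at hj
    have hj' : (k:ℝ) ≤ j := by exact_mod_cast hj.1
    have e1 : (j:ℝ) - i ≠ 0 := by linarith
    have e2 : a i - i + j ≠ 0 := by linarith
    simp only [bump, hi, if_true, show ¬ j < k by omega, if_false, h0 j hj.1]
    field_simp
    ring
  have B1 : ∏ j ∈ Ico (i+1) k, (bump k a i + bump k a j + (2 * (n:ℝ) - i - j)) / (2 * (n:ℝ) - i - j) =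
      (∏ j ∈ Ico (i+1) k, (a i + a j + (2 * (n:ℝ) - i - j)) / (2 * (n:ℝ) - i - j)) *
      ∏ j ∈ Ico (i+1) k, (a i + a j + (2 * (n:ℝ) - i - j) + 2) / (a i + a j + (2 * (n:ℝ) - i - j)) := by
    rw [← prod_mul_distrib]
    refine prod_congr rfl fun j hj => ?_
    rw [mem_Ico] at hj
    have hj' : (j:ℝ) + 1 ≤ k := by exact_mod_cast hj.2
    have := ha j
    have e1 : 2 * (n:ℝ) - i - j ≠ 0 := by linarith
    have e2 : a i + a j + (2 * (n:ℝ) - i - j) ≠ 0 := by linarith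
    simp only [bump, hi, if_true, hj.2]
    field_simp
    ring
  have B2 : ∏ j ∈ Ico k n, (bump k a i + bump k a j + (2 * (n:ℝ) - i - j)) / (2 * (n:ℝ) - i - j) =
      (∏ j ∈ Ico k n, (a i + a j + (2 * (n:ℝ) - i - j)) / (2 * (n:ℝ) - i - j)) *
        ((a i + 2 * n - i + 1 - k) / (a i + 2 * n - i + 1 - n)) := by
    rw [← tele2 (a i + 2 * n - i) k n hk (by linarith), ← prod_mul_distrib]
    refine prod_congr rfl fun j hj => ?_
    rw [mem_Ico] at hj
    have hj' : (j:ℝ) + 1 ≤ n := by exact_mod_cast hj.2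
    have e1 : 2 * (n:ℝ) - i - j ≠ 0 := by linarith
    have e2 : a i + 2 * (n:ℝ) - i - j ≠ 0 := by linarith
    simp only [bump, hi, if_true, show ¬ j < k by omega, if_false, h0 j hj.1]
    field_simp
    ring
  have B0 : (bump k a i + bump k a i + (2 * (n:ℝ) - i - i)) / (2 * (n:ℝ) - i - i) =
      (a i + a i + (2 * (n:ℝ) - i - i)) / (2 * (n:ℝ) - i - i) *
        ((a i + n - i + 1) / (a i + n - i)) := by
    have e1 : 2 * (n:ℝ) - i - i ≠ 0 := by linarith
    have e2 : a i + (n:ℝ) - i ≠ 0 := by linarith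
    simp only [bump, hi, if_true]
    field_simp
    ring
  have key : (a i - i + n) / (a i - i + k) * ((a i + 2 * n - i + 1 - k) / (a i + 2 * n - i + 1 - n)) *
      ((a i + n - i + 1) / (a i + n - i)) =
      (a i + (2 * (n:ℝ) + 1 - i - k)) / (a i + ((k:ℝ) - i)) := by
    have e1 : a i - i + (k:ℝ) ≠ 0 := by linarith
    have e2 : a i + (n:ℝ) - i ≠ 0 := by linarith
    have e3 : a i + (n:ℝ) - i + 1 ≠ 0 := by linarith
    have e4 : a i + 2 * n - i + 1 - n = a i + (n:ℝ) - i + 1 := by ring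
    have e5 : a i + ((k:ℝ) - i) = a i - i + k := by ring
    have e6 : a i - i + n = a i + (n:ℝ) - i := by ring
    rw [e4, e5, e6]
    field_simp
    ring
  unfold rowD
  rw [prod_eq_prod_Ico_succ_bot hin (fun j : ℕ => (bump k a i + bump k a j + (2 * (n:ℝ) - i - j)) / (2 * (n:ℝ) - i - j)),
    prod_eq_prod_Ico_succ_bot hin (fun j : ℕ => (a i + a j + (2 * (n:ℝ) - i - j)) / (2 * (n:ℝ) - i - j)),
    ← prod_Ico_consecutive _ (show i + 1 ≤ k from hi) hk,
    ← prod_Ico_consecutive _ (show i + 1 ≤ k from hi) hk,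
    ← prod_Ico_consecutive _ (show i + 1 ≤ k from hi) hk,
    ← prod_Ico_consecutive _ (show i + 1 ≤ k from hi) hk, A1, A2, B1, B2, B0, ← key]
  ring

lemma D_bump (n k : ℕ) (hk : k ≤ n) (a : ℕ → ℝ) (ha : ∀ i, 0 ≤ a i) (h0 : ∀ j, k ≤ j → a j = 0) :
    ∏ i ∈ range n, rowD n (bump k a) i = (∏ i ∈ range n, rowD n a i) * rk n k a := by
  rw [← prod_range_mul_prod_Ico _ hk, ← prod_range_mul_prod_Ico (fun i => rowD n a i) hk, rk,
    prod_congr rfl (fun i hi => row_lt n k hk a ha h0 i (mem_range.1 hi)), prod_mul_distrib,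
    prod_congr rfl (fun i hi => row_ge n k a i (mem_Ico.1 hi).1)]
  ring

lemma frac_le (x y A B : ℝ) (hxy : x ≤ y) (hx : 0 ≤ x) (hB : 0 < B) (hAB : B ≤ A) :
    (y + A) / (y + B) ≤ (x + A) / (x + B) := by
  rw [div_le_div_iff₀ (by linarith) (by linarith)]
  nlinarith

lemma rk_pos (n k : ℕ) (hk : k ≤ n) (a : ℕ → ℝ) (ha : ∀ i, 0 ≤ a i) : 0 < rk n k a := by
  refine prod_pos fun i hi => ?_
  have h1 : (i:ℝ) + 1 ≤ k := by exact_mod_cast mem_range.1 hi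
  have h2 : (k:ℝ) ≤ n := by exact_mod_cast hk
  have := ha i
  refine mul_pos (div_pos (by linarith) (by linarith)) (prod_pos fun j hj => ?_)
  have h3 : (j:ℝ) + 1 ≤ k := by exact_mod_cast (mem_Ico.1 hj).2
  have := ha j
  exact div_pos (by linarith) (by linarith)

lemma rk_anti (n k : ℕ) (hk : k ≤ n) (a b : ℕ → ℝ) (hb : ∀ i, 0 ≤ b i)
    (hab : ∀ i, i < k → b i ≤ a i) : rk n k a ≤ rk n k b := by
  have h2 : (k:ℝ) ≤ n := by exact_mod_cast hk
  have hp : ∀ i j : ℕ, i < k → j ∈ Ico (i+1) k →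
    0 < a i + a j + (2 * (n:ℝ) - i - j) := by
    intro i j hi hj
    have h1 : (i:ℝ) + 1 ≤ k := by exact_mod_cast hi
    have h3 : (j:ℝ) + 1 ≤ k := by exact_mod_cast (mem_Ico.1 hj).2
    have := hab i hi
    have := hab j (mem_Ico.1 hj).2
    have := hb i
    have := hb j
    linarith
  refine prod_le_prod (fun i hi => ?_) (fun i hi => ?_)
  · have hi' := mem_range.1 hi
    have h1 : (i:ℝ) + 1 ≤ k := by exact_mod_cast hi'
    have := hb i
    have := hab i hi'
    refine mul_nonneg (div_nonneg (by linarith) (by linarith)) (prod_nonneg fun j hj => ?_)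
    have := hp i j hi' hj
    positivity
  · have hi' := mem_range.1 hi
    have h1 : (i:ℝ) + 1 ≤ k := by exact_mod_cast hi'
    have := hb i
    have := hab i hi'
    refine mul_le_mul (frac_le _ _ _ _ this (hb i) (by linarith) (by linarith)) ?_ ?_ ?_
    · refine prod_le_prod (fun j hj => ?_) (fun j hj => ?_)
      · have := hp i j hi' hj
        positivity
      · have h3 : (j:ℝ) + 1 ≤ k := by exact_mod_cast (mem_Ico.1 hj).2
        have := hab j (mem_Ico.1 hj).2
        have := hb j
        have := frac_le (b i + b j) (a i + a j) ((2 * (n:ℝ) - i - j) + 2) (2 * (n:ℝ) - i - j)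
          (by linarith) (by linarith) (by linarith) (by linarith)
        simpa only [← add_assoc] using this
    · refine prod_nonneg fun j hj => ?_
      have := hp i j hi' hj
      positivity
    · exact div_nonneg (by linarith) (by linarith)

/-- dimension of the k-th fundamental representation -/
lemma rk_zero (n k : ℕ) (hk : k ≤ n) : rk n k 0 * ∏ i ∈ range k, ((2 * (n:ℝ) + 2 - k - i) * ((k:ℝ) - i))
    = ∏ i ∈ range k, ((2 * (n:ℝ) + 1 - 2 * i) * (2 * n - 2 * i)) := by
  have h2 : (k:ℝ) ≤ n := by exact_mod_cast hk
  rw [rk, ← prod_mul_distrib]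
  refine prod_congr rfl fun i hi => ?_
  have hi' := mem_range.1 hi
  have h1 : (i:ℝ) + 1 ≤ k := by exact_mod_cast hi'
  have e : ∏ j ∈ Ico (i+1) k, ((0:ℕ → ℝ) i + (0:ℕ → ℝ) j + (2 * (n:ℝ) - i - j) + 2) / ((0:ℕ → ℝ) i + (0:ℕ → ℝ) j + (2 * (n:ℝ) - i - j))
     = (∏ j ∈ Ico (i+1) k, ((2 * (n:ℝ) - i + 1) + 1 - j) / ((2 * (n:ℝ) - i + 1) - j)) *
       ∏ j ∈ Ico (i+1) k, ((2 * (n:ℝ) - i) + 1 - j) / ((2 * (n:ℝ) - i) - j) := by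
    rw [← prod_mul_distrib]
    refine prod_congr rfl fun j hj => ?_
    have h3 : (j:ℝ) + 1 ≤ k := by exact_mod_cast (mem_Ico.1 hj).2
    have e1 : 2 * (n:ℝ) - i - j ≠ 0 := by linarith
    have e2 : 2 * (n:ℝ) - i + 1 - j ≠ 0 := by linarith
    simp only [Pi.zero_apply, zero_add]
    field_simp
    ring
  rw [e, tele2 _ _ _ hi' (by linarith), tele2 _ _ _ hi' (by linarith)]
  simp only [Pi.zero_apply, zero_add]
  push_cast
  have e1 : 2 * (n:ℝ) - i + 1 - k ≠ 0 := by linarith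
  have e2 : 2 * (n:ℝ) - i + 1 + 1 - k ≠ 0 := by linarith
  have e3 : (k:ℝ) - i ≠ 0 := by linarith
  have e4 : 2 * (n:ℝ) + 1 - i - k = 2 * (n:ℝ) - i + 1 - k := by ring
  have e5 : 2 * (n:ℝ) + 2 - k - i = 2 * (n:ℝ) - i + 1 + 1 - k := by ring
  rw [e4, e5]
  field_simp
  ring

lemma rk_succ (n k : ℕ) (hk : k + 1 ≤ n) :
    rk n (k+1) 0 = rk n k 0 * (((n:ℝ) - k) * (2 * n + 2 - k) / ((n + 1 - k) * (k + 1))) := by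
  have h2 : (k:ℝ) + 1 ≤ n := by exact_mod_cast hk
  have H1 := rk_zero n (k+1) hk
  have H2 := rk_zero n k (by omega)
  rw [prod_range_succ (fun i : ℕ => ((2 * (n:ℝ) + 1 - 2 * i) * (2 * n - 2 * i))), ← H2] at H1
  rw [prod_mul_distrib, prod_mul_distrib] at H1
  have K : ∏ i ∈ range (k+1), (((k+1:ℕ):ℝ) - i) = (∏ i ∈ range k, ((k:ℝ) - i)) * (k + 1) := by
    rw [prod_range_succ']
    congr 1
    · refine prod_congr rfl fun i _ => ?_
      push_cast; ring
    · push_cast; ring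
  have Q : (2 * (n:ℝ) + 2 - k) * ∏ i ∈ range (k+1), (2 * (n:ℝ) + 2 - ((k+1:ℕ):ℝ) - i) =
     (∏ i ∈ range k, (2 * (n:ℝ) + 2 - k - i)) * ((2 * (n:ℝ) + 2 - 2 * k) * (2 * (n:ℝ) + 1 - 2 * k)) := by
    have := prod_range_succ' (fun i : ℕ => 2 * (n:ℝ) + 2 - k - i) (k+1)
    rw [prod_range_succ, prod_range_succ] at this
    have e : ∏ i ∈ range (k+1), (2 * (n:ℝ) + 2 - ((k+1:ℕ):ℝ) - i) =
      ∏ i ∈ range (k+1), (2 * (n:ℝ) + 2 - (k:ℝ) - (i + 1 : ℕ)) := by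
      refine prod_congr rfl fun i _ => ?_
      push_cast; ring
    rw [e]
    push_cast at this ⊢
    rw [show (2 * (n:ℝ) + 2 - k - 0) = 2 * (n:ℝ) + 2 - k by ring] at this
    rw [mul_comm, ← this]
    ring
  have KP : 0 < ∏ i ∈ range k, ((k:ℝ) - i) := by
    refine prod_pos fun i hi => ?_
    have h1 : (i:ℝ) + 1 ≤ k := by exact_mod_cast mem_range.1 hi
    linarith
  have QP : 0 < ∏ i ∈ range k, (2 * (n:ℝ) + 2 - k - i) := by
    refine prod_pos fun i hi => ?_
    have h1 : (i:ℝ) + 1 ≤ k := by exact_mod_cast mem_range.1 hi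
    linarith
  rw [K] at H1
  set q' := ∏ i ∈ range (k+1), (2 * (n:ℝ) + 2 - ((k+1:ℕ):ℝ) - i)
  set q := ∏ i ∈ range k, (2 * (n:ℝ) + 2 - k - i)
  set kk := ∏ i ∈ range k, ((k:ℝ) - i)
  have p1 : 0 < 2 * (n:ℝ) + 2 - k := by linarith
  have p2 : 0 < (n:ℝ) + 1 - k := by linarith
  have p3 : 0 < 2 * (n:ℝ) + 1 - 2 * k := by linarith
  have p4 : 0 < (k:ℝ) + 1 := by positivity
  have hq' : q' = q * ((2 * (n:ℝ) + 2 - 2 * k) * (2 * (n:ℝ) + 1 - 2 * k)) / (2 * (n:ℝ) + 2 - k) := by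
    rw [eq_div_iff p1.ne']; linarith
  rw [hq'] at H1
  rw [mul_div_assoc', eq_div_iff (by positivity)]
  have big : q * kk * (2 * (n:ℝ) + 1 - 2 * k) * 2 ≠ 0 := by positivity
  apply mul_left_cancel₀ big
  rw [div_mul_eq_mul_div, mul_div_assoc', div_eq_iff p1.ne'] at H1
  linear_combination H1

lemma T_le (n m : ℕ) (hn : 1 ≤ n) (T P Q : ℝ) (hT0 : 0 ≤ T) (hT : T ^ (2 * n) = n) (hP : 0 ≤ P)
    (hQ : 0 ≤ Q) (h : (n:ℝ) ^ m * P ^ (2 * n) ≤ Q ^ (2 * n)) : T ^ m * P ≤ Q := by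
  have h2 : 2 * n ≠ 0 := by omega
  rw [← pow_le_pow_iff_left₀ (by positivity) hQ h2, mul_pow, ← pow_mul, mul_comm m, pow_mul, hT]
  exact h

lemma chord (A u v : ℝ) (hu : 0 ≤ u) (huv : u ≤ v) (hvA : v < A) (hv : 0 < v) :
    v * Real.log ((A + u) / (A - u)) ≤ u * Real.log ((A + v) / (A - v)) := by
  have hA : 0 < A := by linarith
  have hx : |u / A| < 1 := by
    rw [abs_of_nonneg (by positivity), div_lt_one hA]; linarith
  have hy : |v / A| < 1 := by
    rw [abs_of_nonneg (by positivity), div_lt_one hA]; linarith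
  have e : ∀ w : ℝ, 0 ≤ w → w < A → Real.log ((A + w) / (A - w)) = Real.log (1 + w / A) - Real.log (1 - w / A) := by
    intro w hw hwA
    have h1 : 0 < 1 - w / A := by rw [sub_pos, div_lt_one hA]; exact hwA
    rw [← Real.log_div (by positivity) h1.ne']
    congr 1
    have h2 : A - w ≠ 0 := by linarith
    have h3 : 1 - w / A = (A - w) / A := by field_simp
    have h4 : 1 + w / A = (A + w) / A := by field_simp
    rw [h3, h4]
    field_simp
  rw [e u hu (by linarith), e v hv.le hvA]
  have S1 := (Real.hasSum_log_sub_log_of_abs_lt_one hx).mul_left v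
  have S2 := (Real.hasSum_log_sub_log_of_abs_lt_one hy).mul_left u
  refine hasSum_le (fun k => ?_) S1 S2
  have : (u / A) ^ (2 * k) ≤ (v / A) ^ (2 * k) := by gcongr
  have e1 : v * (2 * (1 / (2 * (k:ℝ) + 1)) * (u / A) ^ (2 * k + 1)) =
     (2 * (1 / (2 * (k:ℝ) + 1)) * (u * v / A)) * (u / A) ^ (2 * k) := by
    rw [pow_succ]; ring
  have e2 : u * (2 * (1 / (2 * (k:ℝ) + 1)) * (v / A) ^ (2 * k + 1)) =
     (2 * (1 / (2 * (k:ℝ) + 1)) * (u * v / A)) * (v / A) ^ (2 * k) := by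
    rw [pow_succ]; ring
  rw [e1, e2]
  gcongr

lemma d0 (n : ℕ) : rk n 0 0 = 1 := by simp [rk]
lemma d1 (n : ℕ) (hn : 1 ≤ n) : rk n 1 0 = 2 * n := by
  have h : (1:ℝ) ≤ n := by exact_mod_cast hn
  rw [rk_succ n 0 hn, d0]
  push_cast
  rw [sub_zero, sub_zero]
  field_simp
  ring
lemma d2 (n : ℕ) (hn : 2 ≤ n) : rk n 2 0 = (n - 1) * (2 * n + 1) := by
  have h : (2:ℝ) ≤ n := by exact_mod_cast hn
  rw [rk_succ n 1 hn, d1 n (by omega)]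
  push_cast
  have e : (n:ℝ) + 1 - 1 = n := by ring
  rw [e]
  field_simp
  ring
lemma d3 (n : ℕ) (hn : 3 ≤ n) : rk n 3 0 = 2 * n * (2 * n + 1) * (n - 2) / 3 := by
  have h : (3:ℝ) ≤ n := by exact_mod_cast hn
  rw [rk_succ n 2 hn, d2 n (by omega)]
  push_cast
  have e : (n:ℝ) + 1 - 2 = n - 1 := by ring
  have e' : (n:ℝ) - 1 ≠ 0 := by linarith
  rw [e]
  field_simp
  ring
lemma d4 (n : ℕ) (hn : 4 ≤ n) : rk n 4 0 = (2 * n + 1) * n * (2 * n - 1) * (n - 3) / 6 := by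
  have h : (4:ℝ) ≤ n := by exact_mod_cast hn
  rw [rk_succ n 3 hn, d3 n (by omega)]
  push_cast
  have e : (n:ℝ) + 1 - 3 = n - 2 := by ring
  have e' : (n:ℝ) - 2 ≠ 0 := by linarith
  rw [e]
  field_simp
  ring
lemma d5 (n : ℕ) (hn : 5 ≤ n) :
    rk n 5 0 = (2 * n + 1) * n * (2 * n - 1) * (n - 1) * (n - 4) / 15 := by
  have h : (5:ℝ) ≤ n := by exact_mod_cast hn
  rw [rk_succ n 4 hn, d4 n (by omega)]
  push_cast
  have e : (n:ℝ) + 1 - 4 = n - 3 := by ring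
  have e' : (n:ℝ) - 3 ≠ 0 := by linarith
  rw [e]
  field_simp
  ring

lemma grow (m p q n0 : ℕ) (h0 : n0 ^ m * p ^ (2 * n0) ≤ q ^ (2 * n0))
    (hs : (n0 + 1) ^ m * p ^ 2 ≤ q ^ 2 * n0 ^ m) (hn0 : 0 < n0) (n : ℕ) (hn : n0 ≤ n) :
    n ^ m * p ^ (2 * n) ≤ q ^ (2 * n) := by
  induction n, hn using Nat.le_induction with
  | base => exact h0
  | succ k hk ih =>
    have h1 : (n0 * (k + 1)) ^ m ≤ ((n0 + 1) * k) ^ m := Nat.pow_le_pow_left (by nlinarith) m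
    rw [mul_pow, mul_pow] at h1
    have h2 : 0 < n0 ^ m := by positivity
    refine Nat.le_of_mul_le_mul_left ?_ h2
    calc n0 ^ m * ((k + 1) ^ m * p ^ (2 * (k + 1)))
        = (n0 ^ m * (k + 1) ^ m) * (p ^ (2 * k) * p ^ 2) := by ring
      _ ≤ ((n0 + 1) ^ m * k ^ m) * (p ^ (2 * k) * p ^ 2) := by gcongr
      _ = ((n0 + 1) ^ m * p ^ 2) * (k ^ m * p ^ (2 * k)) := by ring
      _ ≤ (q ^ 2 * n0 ^ m) * q ^ (2 * k) := by gcongr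
      _ = n0 ^ m * q ^ (2 * (k + 1)) := by ring

lemma b3 (n : ℕ) (hn : 3 ≤ n) (T : ℝ) (hT0 : 0 ≤ T) (hT : T ^ (2 * n) = n) :
    T ^ 3 * ((2 * n + 1) * (n - 2) * 8) ≤ 21 * (n:ℝ) ^ 2 := by
  rcases lt_or_ge n 15 with h | h
  · interval_cases n <;>
    exact T_le _ _ (by norm_num) _ _ _ hT0 hT (by norm_num) (by norm_num) (by norm_num)
  · have g := grow 3 16 21 15 (by norm_num) (by norm_num) (by norm_num) n h
    have h' := T_le n 3 (by omega) T 16 21 hT0 hT (by norm_num) (by norm_num) (by exact_mod_cast g)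
    have hn' : (15:ℝ) ≤ n := by exact_mod_cast h
    have : T ^ 3 * 16 * (n:ℝ) ^ 2 ≤ 21 * (n:ℝ) ^ 2 := by gcongr
    refine le_trans ?_ this
    rw [mul_assoc (T ^ 3)]
    refine mul_le_mul_of_nonneg_left ?_ (by positivity)
    nlinarith

lemma b4 (n : ℕ) (hn : 4 ≤ n) (T : ℝ) (hT0 : 0 ≤ T) (hT : T ^ (2 * n) = n) :
    T ^ 8 * ((2 * n + 1) * (2 * n - 1) * (n - 3) * 2) ≤ 21 * (n:ℝ) ^ 3 := by
  rcases lt_or_ge n 10 with h | h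
  · interval_cases n <;>
    exact T_le _ _ (by norm_num) _ _ _ hT0 hT (by norm_num) (by norm_num) (by norm_num)
  · have g := grow 8 8 21 10 (by norm_num) (by norm_num) (by norm_num) n h
    have h' := T_le n 8 (by omega) T 8 21 hT0 hT (by norm_num) (by norm_num) (by exact_mod_cast g)
    have hn' : (10:ℝ) ≤ n := by exact_mod_cast h
    have : T ^ 8 * 8 * (n:ℝ) ^ 3 ≤ 21 * (n:ℝ) ^ 3 := by gcongr
    refine le_trans ?_ this
    rw [mul_assoc (T ^ 8)]
    refine mul_le_mul_of_nonneg_left ?_ (by positivity)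
    nlinarith [sq_nonneg (n:ℝ)]

lemma b5 (n : ℕ) (hn : 5 ≤ n) (T : ℝ) (hT0 : 0 ≤ T) (hT : T ^ (2 * n) = n) :
    T ^ 15 * ((2 * n + 1) * (2 * n - 1) * (n - 1) * (n - 4)) ≤ 15 * (n:ℝ) ^ 4 := by
  rcases lt_or_ge n 20 with h | h
  · interval_cases n <;>
    exact T_le _ _ (by norm_num) _ _ _ hT0 hT (by norm_num) (by norm_num) (by norm_num)
  · have g := grow 15 4 15 20 (by norm_num) (by norm_num) (by norm_num) n h
    have h' := T_le n 15 (by omega) T 4 15 hT0 hT (by norm_num) (by norm_num) (by exact_mod_cast g)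
    have hn' : (20:ℝ) ≤ n := by exact_mod_cast h
    have : T ^ 15 * 4 * (n:ℝ) ^ 4 ≤ 15 * (n:ℝ) ^ 4 := by gcongr
    refine le_trans ?_ this
    rw [mul_assoc (T ^ 15)]
    refine mul_le_mul_of_nonneg_left ?_ (by positivity)
    have h1 : (2 * (n:ℝ) + 1) * (2 * n - 1) ≤ 4 * n ^ 2 := by nlinarith
    have h2 : ((n:ℝ) - 1) * (n - 4) ≤ n ^ 2 := by nlinarith
    have h3 : 0 ≤ ((n:ℝ) - 1) * (n - 4) := mul_nonneg (by linarith) (by linarith)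
    calc (2 * (n:ℝ) + 1) * (2 * n - 1) * (n - 1) * (n - 4)
        = ((2 * (n:ℝ) + 1) * (2 * n - 1)) * ((n - 1) * (n - 4)) := by ring
      _ ≤ (4 * (n:ℝ) ^ 2) * n ^ 2 := by gcongr
      _ = 4 * (n:ℝ) ^ 4 := by ring

lemma b9 (n : ℕ) (hn : 6 ≤ n) (T : ℝ) (hT0 : 0 ≤ T) (hT : T ^ (2 * n) = n) :
    T ^ 9 * (2 * n - 3) ≤ 6 * (n:ℝ) := by
  rcases lt_or_ge n 9 with h | h
  · interval_cases n <;>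
    exact T_le _ _ (by norm_num) _ _ _ hT0 hT (by norm_num) (by norm_num) (by norm_num)
  · have g := grow 9 1 3 9 (by norm_num) (by norm_num) (by norm_num) n h
    have h' := T_le n 9 (by omega) T 1 3 hT0 hT (by norm_num) (by norm_num) (by exact_mod_cast g)
    have hn' : (9:ℝ) ≤ n := by exact_mod_cast h
    have : T ^ 9 * 1 * (2 * n) ≤ 3 * (2 * (n:ℝ)) := by gcongr
    have h3 : 0 ≤ T ^ 9 := by positivity
    nlinarith

lemma incr (n k : ℕ) (hk5 : 5 ≤ k) (hk : k + 1 ≤ n) (T : ℝ) (hT1 : 1 ≤ T)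
    (hT : T ^ (2 * n) = n) :
    ((n:ℝ) - k) * (2 * n + 2 - k) / ((n + 1 - k) * (k + 1)) ≤ T ^ (2 * n + 1 - 2 * k) := by
  have hT0 : 0 < T := by linarith
  have hk' : (k:ℝ) + 1 ≤ n := by exact_mod_cast hk
  have hk5' : (5:ℝ) ≤ k := by exact_mod_cast hk5
  have hlog : 0 ≤ Real.log T := Real.log_nonneg hT1
  have c := chord (2 * n + 3) (2 * n + 1 - 2 * k) (2 * n - 9) (by linarith) (by linarith)
    (by linarith) (by linarith)
  have e9 := b9 n (by omega) T hT0.le hT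
  have h9 : (2 * (n:ℝ) + 3 + (2 * n - 9)) / (2 * n + 3 - (2 * n - 9)) ≤ T ^ (2 * n - 9) := by
    have e : T ^ (2 * n - 9) * T ^ 9 = n := by rw [← pow_add, ← hT]; congr 1; omega
    rw [div_le_iff₀ (by linarith)]
    have : 0 < T ^ 9 := by positivity
    have e9' : T ^ 9 * (2 * n - 3) ≤ T ^ 9 * (6 * T ^ (2 * n - 9)) := by
      calc _ ≤ _ := e9
        _ = _ := by rw [← e]; ring
    have := le_of_mul_le_mul_left e9' this
    linarith
  have l9 := Real.log_le_log (div_pos (by linarith) (by linarith)) h9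
  rw [Real.log_pow, Nat.cast_sub (by omega)] at l9
  push_cast at l9
  have pos : 0 < (2 * (n:ℝ) + 3 + (2 * n + 1 - 2 * k)) / (2 * n + 3 - (2 * n + 1 - 2 * k)) :=
    div_pos (by linarith) (by linarith)
  have fin : (2 * (n:ℝ) + 3 + (2 * n + 1 - 2 * k)) / (2 * n + 3 - (2 * n + 1 - 2 * k)) ≤
      T ^ (2 * n + 1 - 2 * k) := by
    rw [← Real.log_le_log_iff pos (by positivity), Real.log_pow, Nat.cast_sub (by omega)]
    push_cast
    have hv : 0 < 2 * (n:ℝ) - 9 := by linarith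
    refine le_of_mul_le_mul_left (c.trans ?_) hv
    have hu : 0 ≤ 2 * (n:ℝ) + 1 - 2 * k := by linarith
    have := mul_le_mul_of_nonneg_left l9 hu
    linarith
  refine le_trans ?_ fin
  rw [div_le_div_iff₀ (mul_pos (by linarith) (by linarith)) (by linarith)]
  have h1 : 0 ≤ (2 * (n:ℝ) + 2 - k) * (k + 1) := mul_nonneg (by linarith) (by linarith)
  nlinarith

lemma dk (n k : ℕ) (hk5 : 5 ≤ k) (hk : k ≤ n) (T : ℝ) (hT1 : 1 ≤ T) (hT : T ^ (2 * n) = n) :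
    rk n k 0 ≤ T ^ (k * (2 * n + 2 - k)) := by
  have hT0 : 0 < T := by linarith
  induction k, hk5 using Nat.le_induction with
  | base =>
    have e5 := b5 n hk T hT0.le hT
    rw [d5 n hk]
    have hp : 0 < T ^ 15 := by positivity
    refine le_of_mul_le_mul_left ?_ hp
    have e : T ^ 15 * T ^ (5 * (2 * n + 2 - 5)) = (n:ℝ) ^ 5 := by
      rw [← pow_add, ← hT, ← pow_mul]; congr 1; omega
    rw [e]
    have : (0:ℝ) ≤ n := by positivity
    nlinarith [mul_le_mul_of_nonneg_left e5 this]
  | succ m hm ih =>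
    rw [rk_succ n m hk]
    have i1 := ih (by omega)
    have i2 := incr n m hm hk T hT1 hT
    have hpos : 0 ≤ ((n:ℝ) - m) * (2 * n + 2 - m) / ((n + 1 - m) * (m + 1)) := by
      have hk' : (m:ℝ) + 1 ≤ n := by exact_mod_cast hk
      refine div_nonneg (mul_nonneg ?_ ?_) (mul_nonneg ?_ ?_) <;> linarith
    calc _ ≤ T ^ (m * (2 * n + 2 - m)) * T ^ (2 * n + 1 - 2 * m) := by gcongr
      _ = _ := by
        rw [← pow_add]
        congr 1
        obtain ⟨c, rfl⟩ := Nat.exists_eq_add_of_le hk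
        have h1 : 2 * (m + 1 + c) + 2 - m = m + 4 + 2 * c := by omega
        have h2 : 2 * (m + 1 + c) + 1 - 2 * m = 3 + 2 * c := by omega
        have h3 : 2 * (m + 1 + c) + 2 - (m + 1) = m + 3 + 2 * c := by omega
        rw [h1, h2, h3]
        ring

lemma c1 (n : ℕ) : rk n 1 (fun i => if i < 1 then 1 else 0) = (2 * n + 1) / 2 := by
  simp [rk]
  ring

lemma c21 (n : ℕ) (hn : 3 ≤ n) :
    rk n 2 (fun i => if i < 1 then 1 else 0) = 4 * ((n:ℝ) ^ 2 - 1) / 3 := by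
  have h : (3:ℝ) ≤ n := by exact_mod_cast hn
  simp [rk, prod_range_succ]
  field_simp
  ring

lemma c22 (n : ℕ) (hn : 3 ≤ n) :
    rk n 2 (fun i => if i < 2 then 1 else 0) = (2 * n - 1) * (2 * n) * (2 * n + 3) / (6 * (2 * n + 1)) := by
  have h : (3:ℝ) ≤ n := by exact_mod_cast hn
  simp [rk, prod_range_succ]
  rw [show (1:ℝ) + 2 * n = 2 * n + 1 by ring]
  field_simp
  ring

lemma c33 (n : ℕ) (hn : 3 ≤ n) :
    rk n 3 (fun i => if i < 3 then 1 else 0) =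
      (2 * n - 2) * (2 * n - 3) * (2 * n + 3) * (2 * n + 2) / (48 * n) := by
  have h : (3:ℝ) ≤ n := by exact_mod_cast hn
  simp [rk, prod_range_succ, Finset.prod_Ico_succ_top]
  rw [show (1:ℝ) + 2 * n = 2 * n + 1 by ring,
    show (1:ℝ) + 1 + (2 * n - 2) = 2 * n by ring,
    show (1:ℝ) + 1 + (2 * n - 1 - 2) = 2 * n - 1 by ring]
  have e : 2 * (n:ℝ) - 1 ≠ 0 := by linarith
  field_simp
  ring

lemma c43 (n : ℕ) (hn : 4 ≤ n) :
    rk n 4 (fun i => if i < 3 then 1 else 0) =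
      (2 * n - 2) * (2 * n - 6) * (2 * n + 3) * (2 * n + 2) / 60 := by
  have h : (4:ℝ) ≤ n := by exact_mod_cast hn
  simp [rk, prod_range_succ, Finset.prod_Ico_succ_top]
  rw [show (1:ℝ) + 2 * n = 2 * n + 1 by ring,
    show (1:ℝ) + 1 + (2 * n - 2) = 2 * n by ring,
    show (1:ℝ) + 1 + (2 * n - 1 - 2) = 2 * n - 1 by ring,
    show (1:ℝ) + (2 * n - 3) = 2 * (n - 1) by ring,
    show (1:ℝ) + (2 * n - 1 - 3) = 2 * n - 3 by ring,
    show (1:ℝ) + (2 * n - 2 - 3) = 2 * (n - 2) by ring]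
  have e1 : 2 * (n:ℝ) - 1 ≠ 0 := by linarith
  have e2 : (n:ℝ) - 1 ≠ 0 := by linarith
  have e3 : 2 * (n:ℝ) - 3 ≠ 0 := by linarith
  have e4 : (n:ℝ) - 2 ≠ 0 := by linarith
  field_simp
  ring

noncomputable def cc (a : ℕ → ℕ) : ℝ :=
  (if a 0 = 0 then 1 else if a 1 = 0 then 2 else 8 / 3) * (if a 2 = 0 then 1 else 7 / 4)

def EE (n : ℕ) (a : ℕ → ℕ) : ℕ := ∑ i ∈ range n, (a i ^ 2 + (2 * n - 2 * i) * a i)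

lemma EE_bump (n k : ℕ) (hk : k ≤ n) (a : ℕ → ℕ) :
    EE n (fun i => if i < k then a i + 1 else a i) =
      EE n a + (k * (2 * n + 2 - k) + 2 * ∑ i ∈ range k, a i) := by
  have hs : ∀ m, m ≤ n → ∑ i ∈ range m, (2 * n + 1 - 2 * i) = m * (2 * n + 2 - m) := by
    intro m hm
    induction m with
    | zero => simp
    | succ m ih =>
      rw [sum_range_succ, ih (by omega)]
      obtain ⟨c, rfl⟩ := Nat.exists_eq_add_of_le hm
      have h1 : 2 * (m + 1 + c) + 2 - m = m + 4 + 2 * c := by omega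
      have h2 : 2 * (m + 1 + c) + 1 - 2 * m = 3 + 2 * c := by omega
      have h3 : 2 * (m + 1 + c) + 2 - (m + 1) = m + 3 + 2 * c := by omega
      rw [h1, h2, h3]
      ring
  unfold EE
  rw [← sum_range_add_sum_Ico _ hk, ← sum_range_add_sum_Ico (fun i => a i ^ 2 + (2 * n - 2 * i) * a i) hk,
    ← hs k hk, mul_sum]
  have A : ∑ i ∈ range k, ((if i < k then a i + 1 else a i) ^ 2 + (2 * n - 2 * i) * (if i < k then a i + 1 else a i))
     = ∑ i ∈ range k, (a i ^ 2 + (2 * n - 2 * i) * a i) + (∑ i ∈ range k, (2 * n + 1 - 2 * i) + ∑ i ∈ range k, 2 * a i) := by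
    rw [← sum_add_distrib, ← sum_add_distrib]
    refine sum_congr rfl fun i hi => ?_
    have hi' := mem_range.1 hi
    rw [if_pos hi', show 2 * n + 1 - 2 * i = (2 * n - 2 * i) + 1 by omega]
    ring
  have B : ∑ i ∈ Ico k n, ((if i < k then a i + 1 else a i) ^ 2 + (2 * n - 2 * i) * (if i < k then a i + 1 else a i))
     = ∑ i ∈ Ico k n, (a i ^ 2 + (2 * n - 2 * i) * a i) := by
    refine sum_congr rfl fun i hi => ?_
    rw [if_neg (by have := (mem_Ico.1 hi).1; omega)]
  rw [A, B]
  ring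

/-- one step: adding a column of height k -/
lemma step (n : ℕ) (hn : 3 ≤ n) (k : ℕ) (hk1 : 1 ≤ k) (hk : k ≤ n) (T : ℝ) (hT1 : 1 ≤ T)
    (hT : T ^ (2 * n) = n) (a : ℕ → ℕ) (ha : Antitone a) (h0 : ∀ j, k ≤ j → a j = 0) :
    cc a * rk n k (fun i => (a i : ℝ)) ≤ cc (fun i => if i < k then a i + 1 else a i) *
      T ^ (k * (2 * n + 2 - k) + 2 * ∑ i ∈ range k, a i) := by
  have hT0 : 0 < T := by linarith
  have hn' : (3:ℝ) ≤ n := by exact_mod_cast hn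
  have ha1 : a 1 ≤ a 0 := ha (by norm_num)
  have ha2 : a 2 ≤ a 1 := ha (by norm_num)
  have hb : rk n k (fun i => (a i : ℝ)) ≤ rk n k 0 :=
    rk_anti n k hk _ _ (fun _ => le_rfl) (fun i _ => by simp)
  have hb' : ∀ m, (∀ i, i < m → 1 ≤ a i) →
      rk n k (fun i => (a i : ℝ)) ≤ rk n k (fun i => if i < m then 1 else 0) := by
    intro m hm
    refine rk_anti n k hk _ _ (fun i => by split_ifs <;> norm_num) (fun i _ => ?_)
    split_ifs with h
    · exact_mod_cast hm i h
    · positivity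
  have hr := rk_pos n k hk (fun i => (a i : ℝ)) (fun i => by positivity)
  have hmono : ∀ p q : ℕ, p ≤ q → T ^ p ≤ T ^ q := fun p q h => pow_le_pow_right₀ hT1 h
  have comb : ∀ C c c' : ℝ, 0 ≤ c → c * C ≤ c' →
      rk n k (fun i => (a i : ℝ)) ≤ C * T ^ (k * (2 * n + 2 - k) + 2 * ∑ i ∈ range k, a i) →
      c * rk n k (fun i => (a i : ℝ)) ≤ c' * T ^ (k * (2 * n + 2 - k) + 2 * ∑ i ∈ range k, a i) := by
    intro C c c' hc h1 h2
    calc _ ≤ c * (C * T ^ (k * (2 * n + 2 - k) + 2 * ∑ i ∈ range k, a i)) := by gcongr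
      _ = (c * C) * T ^ (k * (2 * n + 2 - k) + 2 * ∑ i ∈ range k, a i) := by ring
      _ ≤ _ := by gcongr
  have hTm : ∀ m : ℕ, T ^ (2 * n * m) = (n:ℝ) ^ m := fun m => by rw [pow_mul, hT]
  rcases le_or_gt 5 k with h5 | h5
  · refine comb 1 _ _ (by unfold cc; positivity) ?_ ?_
    · simp only [cc, show 0 < k by omega, show 1 < k by omega, show 2 < k by omega, if_true]
      split_ifs <;> first | contradiction | omega | norm_num
    · rw [one_mul]
      exact hb.trans ((dk n k h5 hk T hT1 hT).trans (hmono _ _ (by omega)))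
  interval_cases k
  · -- k = 1
    have a1 := h0 1 le_rfl
    have a2 := h0 2 (by norm_num)
    by_cases z : a 0 = 0
    · refine comb 2 _ _ (by unfold cc; positivity) ?_ ?_
      · simp [cc, z, a1, a2]
      · rw [d1 n (by omega)] at hb
        have := hmono (2 * n * 1) (1 * (2 * n + 2 - 1) + 2 * ∑ i ∈ range 1, a i) (by omega)
        rw [hTm] at this
        linarith
    · refine comb 1 _ _ (by unfold cc; positivity) ?_ ?_
      · simp [cc, z, a1, a2]
      · have hb1 := hb' 1 (by intro i hi; interval_cases i; omega)
        rw [c1] at hb1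
        have := hmono (2 * n * 1 + 1) (1 * (2 * n + 2 - 1) + 2 * ∑ i ∈ range 1, a i) (by omega)
        rw [pow_succ, hTm] at this
        have ht : 1 * (1 + 1 / (2 * (n:ℝ))) ≤ T := by
          rw [one_mul]
          have h2 : 2 * n ≠ 0 := by omega
          rw [← pow_le_pow_iff_left₀ (by positivity) hT0.le h2, hT]
          have h3 : (1 + 1 / (2 * (n:ℝ))) ≤ Real.exp (1 / (2 * (n:ℝ))) := by
            have := Real.add_one_le_exp (1 / (2 * (n:ℝ))); linarith
          calc _ ≤ (Real.exp (1 / (2 * (n:ℝ)))) ^ (2 * n) := by gcongr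
            _ = Real.exp 1 := by
              rw [← Real.exp_nat_mul]; congr 1; push_cast; field_simp
            _ ≤ 3 := by have := Real.exp_one_lt_d9; linarith
            _ ≤ n := hn'
        have h4 := mul_le_mul_of_nonneg_left ht (show (0:ℝ) ≤ n by positivity)
        have h5 : (n:ℝ) * (1 * (1 + 1 / (2 * (n:ℝ)))) = n + 1 / 2 := by field_simp
        rw [h5] at h4
        rw [one_mul]
        rw [pow_one] at this
        linarith
  · -- k = 2
    have a2 := h0 2 le_rfl
    have := hmono (2 * n * 2) (2 * (2 * n + 2 - 2) + 2 * ∑ i ∈ range 2, a i) (by omega)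
    rw [hTm] at this
    by_cases z : a 0 = 0
    · refine comb (8/3) _ _ (by unfold cc; positivity) ?_ ?_
      · simp [cc, z, a2]
      · rw [d2 n (by omega)] at hb
        nlinarith
    by_cases z1 : a 1 = 0
    · refine comb (4/3) _ _ (by unfold cc; positivity) ?_ ?_
      · simp [cc, z, z1, a2]; norm_num
      · have hb1 := hb' 1 (by intro i hi; interval_cases i; omega)
        rw [c21 n hn] at hb1
        linarith
    · refine comb 1 _ _ (by unfold cc; positivity) ?_ ?_
      · simp [cc, z, z1, a2]
      · have hb1 := hb' 2 (by intro i hi; interval_cases i <;> omega)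
        rw [c22 n hn] at hb1
        rw [one_mul]
        refine (hb1.trans ?_).trans this
        rw [div_le_iff₀ (by positivity)]
        nlinarith [sq_nonneg (n:ℝ), mul_nonneg (show (0:ℝ) ≤ n by positivity) (show (0:ℝ) ≤ n - 3 by linarith), mul_nonneg (show (0:ℝ) ≤ n^2 by positivity) (show (0:ℝ) ≤ n - 3 by linarith)]
  · -- k = 3
    by_cases z : a 2 = 0
    · refine comb (7/4) _ _ (by unfold cc; positivity) ?_ ?_
      · simp only [cc, z]
        norm_num
        split_ifs <;> norm_num
      · rw [d3 n hn] at hb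
        have e3 := b3 n hn T hT0.le hT
        refine hb.trans (le_trans ?_ (mul_le_mul_of_nonneg_left (hmono (6 * n - 3) _ (by omega)) (by norm_num)))
        have hp : 0 < T ^ 3 := by positivity
        refine le_of_mul_le_mul_left ?_ hp
        have e : T ^ 3 * T ^ (6 * n - 3) = (n:ℝ) ^ 3 := by
          rw [← hTm, ← pow_add]; congr 1; omega
        have e' : T ^ 3 * (7 / 4 * T ^ (6 * n - 3)) = 7 / 4 * (n:ℝ) ^ 3 := by rw [← e]; ring
        rw [e']
        have : (0:ℝ) ≤ n := by positivity
        nlinarith [mul_le_mul_of_nonneg_left e3 this]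
    · refine comb 1 _ _ (by unfold cc; positivity) ?_ ?_
      · simp only [cc, z]
        norm_num
        split_ifs <;> first | contradiction | omega | norm_num
      · have hb1 := hb' 3 (by intro i hi; interval_cases i <;> omega)
        rw [c33 n hn] at hb1
        have := hmono (2 * n * 3) (3 * (2 * n + 2 - 3) + 2 * ∑ i ∈ range 3, a i) (by
          simp only [sum_range_succ, sum_range_zero]; omega)
        rw [hTm] at this
        rw [one_mul]
        refine (hb1.trans ?_).trans this
        rw [div_le_iff₀ (by positivity)]
        have h1 : (2 * (n:ℝ) - 2) * (2 * n + 2) ≤ 4 * n ^ 2 := by nlinarith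
        have h2 : (2 * (n:ℝ) - 3) * (2 * n + 3) ≤ 4 * n ^ 2 := by nlinarith
        have h3 : 0 ≤ (2 * (n:ℝ) - 3) * (2 * n + 3) := mul_nonneg (by linarith) (by linarith)
        calc _ = ((2 * (n:ℝ) - 2) * (2 * n + 2)) * ((2 * (n:ℝ) - 3) * (2 * n + 3)) := by ring
          _ ≤ (4 * (n:ℝ) ^ 2) * (4 * n ^ 2) := by gcongr
          _ ≤ _ := by nlinarith [pow_nonneg (show (0:ℝ) ≤ n by positivity) 4]
  · -- k = 4
    have hn4 : (4:ℝ) ≤ n := by exact_mod_cast hk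
    by_cases z : a 2 = 0
    · refine comb (7/4) _ _ (by unfold cc; positivity) ?_ ?_
      · simp only [cc, z]
        norm_num
        split_ifs <;> norm_num
      · rw [d4 n hk] at hb
        have e3 := b4 n hk T hT0.le hT
        refine hb.trans (le_trans ?_ (mul_le_mul_of_nonneg_left (hmono (8 * n - 8) _ (by omega)) (by norm_num)))
        have hp : 0 < T ^ 8 := by positivity
        refine le_of_mul_le_mul_left ?_ hp
        have e : T ^ 8 * T ^ (8 * n - 8) = (n:ℝ) ^ 4 := by
          rw [← hTm, ← pow_add]; congr 1; omega
        have e' : T ^ 8 * (7 / 4 * T ^ (8 * n - 8)) = 7 / 4 * (n:ℝ) ^ 4 := by rw [← e]; ring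
        rw [e']
        have : (0:ℝ) ≤ n := by positivity
        nlinarith [mul_le_mul_of_nonneg_left e3 this]
    · refine comb 1 _ _ (by unfold cc; positivity) ?_ ?_
      · simp only [cc, z]
        norm_num
        split_ifs <;> first | contradiction | omega | norm_num
      · have hb1 := hb' 3 (by intro i hi; interval_cases i <;> omega)
        rw [c43 n hk] at hb1
        have := hmono (8 * n - 2) (4 * (2 * n + 2 - 4) + 2 * ∑ i ∈ range 4, a i) (by
          simp only [sum_range_succ, sum_range_zero]; omega)
        have t2 : T ^ 2 * 1 ≤ 2 := by
          refine T_le n 2 (by omega) T 1 2 hT0.le hT (by norm_num) (by norm_num) ?_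
          have g := grow 2 1 2 3 (by norm_num) (by norm_num) (by norm_num) n hn
          exact_mod_cast g
        have e : T ^ (8 * n - 2) * T ^ 2 = (n:ℝ) ^ 4 := by
          rw [← hTm, ← pow_add]; congr 1; omega
        have hp : 0 < T ^ (8 * n - 2) := by positivity
        have e2 : (n:ℝ) ^ 4 ≤ T ^ (8 * n - 2) * 2 := by
          rw [← e]; gcongr; linarith
        rw [one_mul]
        refine (hb1.trans ?_).trans this
        have h1 : (2 * (n:ℝ) - 2) * (2 * n + 2) ≤ 4 * n ^ 2 := by nlinarith
        have h2 : (2 * (n:ℝ) - 6) * (2 * n + 3) ≤ 4 * n ^ 2 := by nlinarith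
        have h3 : 0 ≤ (2 * (n:ℝ) - 6) * (2 * n + 3) := mul_nonneg (by linarith) (by linarith)
        have h4 : (2 * (n:ℝ) - 2) * (2 * n - 6) * (2 * n + 3) * (2 * n + 2) ≤ 16 * n ^ 4 := by
          calc _ = ((2 * (n:ℝ) - 2) * (2 * n + 2)) * ((2 * (n:ℝ) - 6) * (2 * n + 3)) := by ring
            _ ≤ (4 * (n:ℝ) ^ 2) * (4 * n ^ 2) := by gcongr
            _ = _ := by ring
        linarith

lemma main_bound (n : ℕ) (hn : 3 ≤ n) (T : ℝ) (hT1 : 1 ≤ T) (hT : T ^ (2 * n) = n) (s : ℕ) :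
    ∀ a : ℕ → ℕ, Antitone a → (∀ j, n ≤ j → a j = 0) → a 0 = s →
      ∏ i ∈ range n, rowD n (fun i => (a i : ℝ)) i ≤ cc a * T ^ EE n a := by
  have hT0 : 0 < T := by linarith
  induction s with
  | zero =>
    intro a ha h0 hs
    have hz : ∀ i, a i = 0 := fun i => Nat.eq_zero_of_le_zero (hs ▸ ha (Nat.zero_le i))
    have h1 : ∏ i ∈ range n, rowD n (fun i => (a i : ℝ)) i = 1 := by
      refine prod_eq_one fun i hi => ?_
      have hi' : (i:ℝ) + 1 ≤ n := by exact_mod_cast mem_range.1 hi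
      unfold rowD
      rw [prod_eq_one, prod_eq_one, one_mul]
      · intro j hj
        have hj' : (j:ℝ) + 1 ≤ n := by exact_mod_cast (mem_Ico.1 hj).2
        have e : 2 * (n:ℝ) - i - j ≠ 0 := by linarith
        simp [hz, e]
      · intro j hj
        have hj' : (i:ℝ) + 1 ≤ j := by exact_mod_cast (mem_Ico.1 hj).1
        have e : (j:ℝ) - i ≠ 0 := by linarith
        simp [hz, e]
    rw [h1]
    simp [cc, EE, hz]
  | succ s ih =>
    intro a ha h0 hs
    have hex : ∃ j, a j = 0 := ⟨n, h0 n le_rfl⟩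
    set k := Nat.find hex with hk
    have hk0 : a k = 0 := Nat.find_spec hex
    have hkn : k ≤ n := Nat.find_min' hex (h0 n le_rfl)
    have hlt : ∀ i, i < k → 1 ≤ a i := fun i hi => Nat.one_le_iff_ne_zero.2 (Nat.find_min hex hi)
    have hge : ∀ i, k ≤ i → a i = 0 := fun i hi => Nat.eq_zero_of_le_zero (hk0 ▸ ha hi)
    have hk1 : 1 ≤ k := by
      by_contra h
      have := hge 0 (by omega)
      omega
    set b : ℕ → ℕ := fun i => a i - 1 with hb
    have hbA : Antitone b := fun i j hij => Nat.sub_le_sub_right (ha hij) 1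
    have hb0 : ∀ j, k ≤ j → b j = 0 := fun j hj => by simp [hb, hge j hj]
    have hab : a = fun i => if i < k then b i + 1 else b i := by
      funext i
      by_cases h : i < k
      · have := hlt i h
        simp only [h, if_true, hb]; omega
      · simp [h, hb, hge i (by omega)]
    have habR : (fun i => (a i : ℝ)) = bump k (fun i => (b i : ℝ)) := by
      funext i
      rw [hab]
      simp only [bump]
      split_ifs <;> push_cast <;> rfl
    have I := ih b hbA (fun j hj => hb0 j (by omega)) (by simp [hb, hs])
    have S := step n hn k hk1 hkn T hT1 hT b hbA hb0
    rw [← hab] at S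
    have E := EE_bump n k hkn b
    rw [← hab] at E
    have hr := rk_pos n k hkn (fun i => (b i : ℝ)) (fun i => by positivity)
    rw [habR, D_bump n k hkn _ (fun i => by positivity) (fun j hj => by simp [hb0 j hj]), E, pow_add]
    calc _ ≤ cc b * T ^ EE n b * rk n k (fun i => (b i : ℝ)) := by gcongr
      _ = (cc b * rk n k (fun i => (b i : ℝ))) * T ^ EE n b := by ring
      _ ≤ (cc a * T ^ (k * (2 * n + 2 - k) + 2 * ∑ i ∈ range k, b i)) * T ^ EE n b := by gcongr
      _ = _ := by ring

lemma cc_le (a : ℕ → ℕ) : cc a ≤ 14 / 3 := by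
  unfold cc
  split_ifs <;> norm_num

/-- For `n ≥ 3` and an integer partition `λ` of length `n`, the Weyl dimension
`D^λ = ∏_{1≤i<j≤n} (λ_i-λ_j+j-i)/(j-i) · ∏_{1≤i≤j≤n} (λ_i+λ_j+2n+2-i-j)/(2n+2-i-j)`
of the irreducible representation of `USp(n,ℍ)` satisfies `D^λ ≤ (14/3)·n^{B_n(λ)}` with
`B_n(λ) = (1/(2n))·∑_{i=1}^n (λ_i² + (2n+2-2i)·λ_i)`. -/
theorem statement5 (n : ℕ) (hn : 3 ≤ n) (lam : Fin n → ℕ) (hanti : Antitone lam) :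
    (∏ i : Fin n, ∏ j ∈ Finset.Ioi i,
        (((lam i : ℝ) - (lam j : ℝ) + ((j : ℕ) : ℝ) - ((i : ℕ) : ℝ)) /
          (((j : ℕ) : ℝ) - ((i : ℕ) : ℝ)))) *
      (∏ i : Fin n, ∏ j ∈ Finset.Ici i,
        (((lam i : ℝ) + (lam j : ℝ) +
            (2 * (n : ℝ) + 2 - (((i : ℕ) : ℝ) + 1) - (((j : ℕ) : ℝ) + 1))) /
          (2 * (n : ℝ) + 2 - (((i : ℕ) : ℝ) + 1) - (((j : ℕ) : ℝ) + 1)))) ≤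
      14 / 3 *
        (n : ℝ) ^
          (1 / (2 * (n : ℝ)) *
            ∑ i : Fin n,
              ((lam i : ℝ) ^ 2 +
                (2 * (n : ℝ) + 2 - 2 * (((i : ℕ) : ℝ) + 1)) * (lam i : ℝ))) := by
  have hn' : (3:ℝ) ≤ n := by exact_mod_cast hn
  set a : ℕ → ℕ := fun i => if h : i < n then lam ⟨i, h⟩ else 0 with ha
  have hlam : ∀ i : Fin n, lam i = a i := fun i => by simp [ha]
  have haA : Antitone a := by
    intro i j hij
    simp only [ha]
    split_ifs with h1 h2
    · exact hanti (by simpa using hij)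
    · omega
    · exact Nat.zero_le _
    · exact le_rfl
  have h0 : ∀ j, n ≤ j → a j = 0 := fun j hj => by simp [ha, show ¬ j < n by omega]
  set T : ℝ := (n:ℝ) ^ (1 / (2 * (n:ℝ))) with hTd
  have hT1 : 1 ≤ T := Real.one_le_rpow (by linarith) (by positivity)
  have hT : T ^ (2 * n) = n := by
    rw [hTd, ← Real.rpow_natCast, ← Real.rpow_mul (by positivity)]
    push_cast
    rw [one_div_mul_cancel (by positivity), Real.rpow_one]
  have M := main_bound n hn T hT1 hT (a 0) a haA h0 rfl
  have M2 : ∏ i ∈ Finset.range n, rowD n (fun i => (a i : ℝ)) i ≤ 14 / 3 * T ^ EE n a :=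
    M.trans (mul_le_mul_of_nonneg_right (cc_le a) (by positivity))
  have hR : (n : ℝ) ^ (1 / (2 * (n : ℝ)) * ∑ i : Fin n, ((lam i : ℝ) ^ 2 +
                (2 * (n : ℝ) + 2 - 2 * (((i : ℕ) : ℝ) + 1)) * (lam i : ℝ))) = T ^ EE n a := by
    rw [Real.rpow_mul (by positivity), ← hTd, ← Real.rpow_natCast]
    congr 1
    unfold EE
    rw [Nat.cast_sum, Finset.sum_range]
    refine Finset.sum_congr rfl fun i _ => ?_
    rw [hlam i]
    push_cast
    rw [Nat.cast_sub (by have := i.2; omega)]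
    push_cast
    ring
  rw [hR]
  refine le_trans (le_of_eq ?_) M2
  rw [← Finset.prod_mul_distrib, Finset.prod_range]
  refine Finset.prod_congr rfl fun i _ => ?_
  unfold rowD
  have e1 : Finset.Ico ((i:ℕ) + 1) n = (Finset.Ioi i).map Fin.valEmbedding := by
    rw [Fin.map_valEmbedding_Ioi]
    ext x
    simp [Finset.mem_Ico, Finset.mem_Ioo, Nat.succ_le_iff]
  have e2 : Finset.Ico (i:ℕ) n = (Finset.Ici i).map Fin.valEmbedding := by
    rw [Fin.map_valEmbedding_Ici]
  rw [e1, e2, Finset.prod_map, Finset.prod_map]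
  congr 1
  · refine Finset.prod_congr rfl fun j _ => ?_
    simp only [hlam, Fin.valEmbedding_apply]
  · refine Finset.prod_congr rfl fun j _ => ?_
    simp only [hlam, Fin.valEmbedding_apply]
    congr 1 <;> ring
end

section
/- Let n ≥ 5. For any integer partition λ = (λ_1 ≥ … ≥ λ_n ≥ 0) of length n, with D^λ = ∏_{1≤i<j≤n} ((λ_i−λ_j+j−i)·(λ_i+λ_j+2n−i−j))/((j−i)·(2n−i−j)) and B_n(λ) = (1/(2n))·∑_{i=1}^n (λ_i² + (2n−2i)·λ_i), one has D^λ ≤ (4/3)·(2n)^{B_n(λ)}. For any half-partition λ of length n (all entries in ℕ + 1/2), with D^λ and B_n(λ) given by the same formulas, one has D^λ ≤ (48/15)·(2n)^{B_n(λ)}. -/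
open Finset

noncomputable def fac (n : ℕ) (x y a b : ℝ) : ℝ :=
  ((x - y + b - a) * (x + y + (2 * (n : ℝ) - (a + 1) - (b + 1)))) /
    ((b - a) * (2 * (n : ℝ) - (a + 1) - (b + 1)))

noncomputable def DD (n : ℕ) (lam : Fin n → ℝ) : ℝ :=
  ∏ i : Fin n, ∏ j ∈ Finset.Ioi i, fac n (lam i) (lam j) ((i : ℕ) : ℝ) ((j : ℕ) : ℝ)

noncomputable def BB (n : ℕ) (lam : Fin n → ℝ) : ℝ :=
  1 / (2 * (n : ℝ)) *
    ∑ i : Fin n, (lam i ^ 2 + (2 * (n : ℝ) - 2 * (((i : ℕ) : ℝ) + 1)) * lam i)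

lemma fin_cast_facts {n : ℕ} {i j : Fin n} (h : i < j) :
    ((i : ℕ) : ℝ) + 1 ≤ ((j : ℕ) : ℝ) ∧ ((j : ℕ) : ℝ) + 1 ≤ (n : ℝ) := by
  have h1 : (i : ℕ) + 1 ≤ (j : ℕ) := h
  have h2 : (j : ℕ) + 1 ≤ n := j.2
  exact ⟨by exact_mod_cast h1, by exact_mod_cast h2⟩

lemma fac_nonneg {n : ℕ} {x y a b : ℝ} (hab : a + 1 ≤ b) (hb : b + 1 ≤ n) (hxy : y ≤ x)
    (hy : 0 ≤ y) : 0 ≤ fac n x y a b := by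
  unfold fac
  apply div_nonneg <;> apply mul_nonneg <;> linarith

lemma aux_ratio {a b c : ℝ} (ha : 0 ≤ a) (hb : 0 ≤ b) (hc : 0 < c) :
    (a + b + c) / c ≤ ((a + c) / c) * ((b + c) / c) := by
  rw [div_mul_div_comm, div_le_div_iff₀ hc (by positivity)]
  nlinarith [mul_nonneg (mul_nonneg ha hb) hc.le]

lemma fac_add {n : ℕ} {x y x' y' a b : ℝ} (hab : a + 1 ≤ b) (hb : b + 1 ≤ n) (hxy : y ≤ x)
    (hy : 0 ≤ y) (hxy' : y' ≤ x') (hy' : 0 ≤ y') :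
    fac n (x + x') (y + y') a b ≤ fac n x y a b * fac n x' y' a b := by
  have h1 := @aux_ratio (x - y) (x' - y') (b - a) (by linarith) (by linarith) (by linarith)
  have h2 := @aux_ratio (x + y) (x' + y') (2 * (n : ℝ) - (a + 1) - (b + 1)) (by linarith)
    (by linarith) (by linarith)
  have h3 := mul_le_mul h1 h2 (by apply div_nonneg <;> linarith)
    (by apply mul_nonneg <;> apply div_nonneg <;> linarith)
  unfold fac
  refine le_of_eq_of_le ?_ (h3.trans (le_of_eq ?_))
  · rw [div_mul_div_comm]; congr 1; ring
  · simp only [div_mul_div_comm]; congr 1 <;> ring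

lemma DD_nonneg {n : ℕ} {lam : Fin n → ℝ} (ha : Antitone lam) (h0 : ∀ i, 0 ≤ lam i) :
    0 ≤ DD n lam := by
  unfold DD
  refine prod_nonneg fun i _ => prod_nonneg fun j hj => ?_
  have hij := Finset.mem_Ioi.1 hj
  exact fac_nonneg (fin_cast_facts hij).1 (fin_cast_facts hij).2 (ha hij.le) (h0 j)

lemma DD_add {n : ℕ} {lam mu : Fin n → ℝ} (ha : Antitone lam) (h0 : ∀ i, 0 ≤ lam i)
    (ha' : Antitone mu) (h0' : ∀ i, 0 ≤ mu i) :
    DD n (fun i => lam i + mu i) ≤ DD n lam * DD n mu := by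
  unfold DD
  simp only [← prod_mul_distrib]
  have key : ∀ i : Fin n, ∀ j ∈ Finset.Ioi i,
      0 ≤ fac n (lam i + mu i) (lam j + mu j) ((i : ℕ) : ℝ) ((j : ℕ) : ℝ) := by
    intro i j hj
    have hij := Finset.mem_Ioi.1 hj
    exact fac_nonneg (fin_cast_facts hij).1 (fin_cast_facts hij).2
      (add_le_add (ha hij.le) (ha' hij.le)) (add_nonneg (h0 j) (h0' j))
  refine prod_le_prod (fun i _ => prod_nonneg (key i)) fun i _ =>
    prod_le_prod (key i) fun j hj => ?_
  have hij := Finset.mem_Ioi.1 hj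
  exact fac_add (fin_cast_facts hij).1 (fin_cast_facts hij).2 (ha hij.le) (h0 j) (ha' hij.le) (h0' j)

lemma BB_add {n : ℕ} (lam mu : Fin n → ℝ) :
    BB n (fun i => lam i + mu i) = BB n lam + BB n mu + 1 / n * ∑ i, lam i * mu i := by
  have : (1 : ℝ) / n = 1 / (2 * (n : ℝ)) * 2 := by
    rw [one_div, one_div, mul_inv]; ring
  unfold BB
  rw [this, mul_assoc, ← mul_add, ← mul_add, mul_sum (s := Finset.univ) (f := fun i => lam i * mu i),
    ← sum_add_distrib, ← sum_add_distrib]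
  congr 1
  refine sum_congr rfl fun i _ => ?_
  ring

/-- indicator of the first k rows -/
noncomputable def om (k : ℕ) (i : ℕ) : ℝ := if i < k then 1 else 0

lemma om_anti (k : ℕ) : Antitone (om k) := by
  intro i j h
  unfold om
  split_ifs <;> first | omega | norm_num

lemma om_nonneg (k i : ℕ) : 0 ≤ om k i := by
  unfold om
  split_ifs <;> norm_num

lemma row1 {n k i : ℕ} (hik : i < k) (hkn : k ≤ n) (m : ℕ) (him : i + 1 ≤ m) (hmk : m ≤ k) :
    (∏ j ∈ Finset.Ico (i + 1) m, fac n (om k i) (om k j) i j) *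
      ((2 * n - i - m) * (2 * n - i - m - 1)) = (2 * n - 2 * i - 1) * (2 * (n : ℝ) - 2 * i - 2) := by
  induction m, him using Nat.le_induction with
  | base => push_cast; simp; ring
  | succ m him ih =>
    have ih := ih (by omega)
    rw [Finset.prod_Ico_succ_top him, ← ih]
    have h1 : ((i : ℝ) + 1) ≤ m := by exact_mod_cast him
    have h2 : ((m : ℝ) + 1) ≤ n := by exact_mod_cast (hmk.trans hkn)
    have e1 : om k i = 1 := if_pos hik
    have e2 : om k m = 1 := if_pos (by omega)
    rw [e1, e2]
    unfold fac
    have h3 : (m : ℝ) - i ≠ 0 := by linarith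
    have h4 : 2 * (n : ℝ) - (i + 1) - (m + 1) ≠ 0 := by linarith
    push_cast
    rw [mul_assoc]
    congr 1
    field_simp
    ring

lemma row2 {n k i : ℕ} (hik : i < k) (m : ℕ) (him : k ≤ m) (hmn : m ≤ n) :
    (∏ j ∈ Finset.Ico (i + 1) m, fac n (om k i) (om k j) i j) *
      ((k - i) * (2 * n - i - m - 1)) =
    (∏ j ∈ Finset.Ico (i + 1) k, fac n (om k i) (om k j) i j) *
      ((m - i) * (2 * n - i - k - 1)) := by
  induction m, him using Nat.le_induction with
  | base => rfl
  | succ m him ih =>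
    have ih := ih (by omega)
    rw [Finset.prod_Ico_succ_top (by omega)]
    have h1 : ((i : ℝ) + 1) ≤ m := by exact_mod_cast (by omega : i + 1 ≤ m)
    have h2 : ((m : ℝ) + 1) ≤ n := by exact_mod_cast hmn
    have e1 : om k i = 1 := if_pos hik
    have e2 : om k m = 0 := if_neg (by omega)
    have h3 : (m : ℝ) - i ≠ 0 := by linarith
    have h4 : 2 * (n : ℝ) - (i + 1) - (m + 1) ≠ 0 := by linarith
    have h5 : fac n (om k i) (om k m) i m * ((m - i) * (2 * (n : ℝ) - (i + 1) - (m + 1)))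
        = (m + 1 - i) * (2 * n - i - m - 1) := by
      rw [e1, e2]
      unfold fac
      rw [div_mul_cancel₀ _ (mul_ne_zero h3 h4)]
      ring
    apply mul_left_cancel₀ h3
    push_cast
    linear_combination (m + 1 - i : ℝ) * ih + (∏ j ∈ Finset.Ico (i + 1) m, fac n (om k i) (om k j) i j) * (k - i) * h5

lemma row {n k i : ℕ} (hik : i < k) (hkn : k ≤ n) :
    (∏ j ∈ Finset.Ico (i + 1) n, fac n (om k i) (om k j) i j) ≤
      (2 * (2 * n - 2 * i - 1) * (n - i)) / ((2 * n - k - i) * (k - i)) := by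
  have h1 : (i : ℝ) + 1 ≤ k := by exact_mod_cast hik
  have h2 : (k : ℝ) ≤ n := by exact_mod_cast hkn
  rcases Nat.lt_or_ge (i + 1) n with h | h
  · have h3 : (i : ℝ) + 1 + 1 ≤ n := by exact_mod_cast h
    have r1 := row1 hik hkn k hik le_rfl
    have r2 := row2 (n := n) hik n hkn le_rfl
    have p1 : 0 < (2 * (n : ℝ) - k - i) := by linarith
    have p2 : 0 < (k : ℝ) - i := by linarith
    rw [le_div_iff₀ (by positivity)]
    apply le_of_eq
    have p3 : (n : ℝ) - i - 1 ≠ 0 := by linarith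
    apply mul_left_cancel₀ p3
    linear_combination (2 * (n : ℝ) - k - i) * r2 + (n - i : ℝ) * r1
  · have hn : n = i + 1 := by omega
    have hk : k = i + 1 := by omega
    subst hn; subst hk
    simp
    ring_nf
    norm_num

lemma Ioi_prod {n : ℕ} (i : Fin n) (f : ℕ → ℝ) :
    ∏ j ∈ Finset.Ioi i, f (j : ℕ) = ∏ j ∈ Finset.Ico ((i : ℕ) + 1) n, f j := by
  have : Finset.Ico ((i : ℕ) + 1) n = (Finset.Ioi i).map Fin.valEmbedding := by
    ext j
    simp only [Finset.mem_Ico, Finset.mem_map, Finset.mem_Ioi, Fin.valEmbedding_apply]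
    constructor
    · rintro ⟨h1, h2⟩
      exact ⟨⟨j, h2⟩, h1, rfl⟩
    · rintro ⟨a, h, rfl⟩
      exact ⟨h, a.2⟩
  rw [this, Finset.prod_map]
  rfl

lemma prodA (n k : ℕ) (hk : k ≤ n) :
    (∏ i ∈ Finset.range k, (2 * (2 * n - 2 * i - 1) * (n - i) : ℝ)) * ((2 * n - 2 * k).factorial : ℝ)
      = ((2 * n).factorial : ℝ) := by
  induction k with
  | zero => simp
  | succ k ih =>
    rw [← ih (by omega), Finset.prod_range_succ]
    obtain ⟨d, rfl⟩ : ∃ d, n = k + 1 + d := ⟨n - (k + 1), by omega⟩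
    have e1 : 2 * (k + 1 + d) - 2 * (k + 1) = 2 * d := by omega
    have e2 : 2 * (k + 1 + d) - 2 * k = 2 * d + 1 + 1 := by omega
    rw [e1, e2, Nat.factorial_succ, Nat.factorial_succ]
    push_cast
    ring

lemma prodB (a k : ℕ) :
    (∏ i ∈ Finset.range k, ((a + k : ℝ) - i)) * (a.factorial : ℝ) = ((a + k).factorial : ℝ) := by
  induction k with
  | zero => simp
  | succ k ih =>
    rw [Finset.prod_range_succ', ← add_assoc, Nat.factorial_succ]
    push_cast
    rw [← ih]
    have : ∀ i ∈ Finset.range k, ((a : ℝ) + (k + 1) - (i + 1)) = a + k - i := fun i _ => by ring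
    rw [prod_congr rfl this]
    ring

lemma DD_om_le (n k : ℕ) (hk : k ≤ n) :
    DD n (fun i => om k (i : ℕ)) ≤ ((2 * n).choose k : ℝ) := by
  have h1 : DD n (fun i => om k (i : ℕ)) =
      ∏ i ∈ Finset.range n, ∏ j ∈ Finset.Ico (i + 1) n, fac n (om k i) (om k j) i j := by
    unfold DD
    rw [Finset.prod_range]
    exact prod_congr rfl fun i _ => Ioi_prod i (fun j => fac n (om k i) (om k j) (i : ℕ) (j : ℕ))
  have nn : ∀ i ∈ Finset.range n, 0 ≤ ∏ j ∈ Finset.Ico (i + 1) n, fac n (om k i) (om k j) i j := by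
    intro i _
    refine prod_nonneg fun j hj => ?_
    obtain ⟨ha, hb⟩ := Finset.mem_Ico.1 hj
    exact fac_nonneg (by exact_mod_cast ha) (by exact_mod_cast hb) (om_anti k (by omega))
      (om_nonneg _ _)
  have h2 : DD n (fun i => om k (i : ℕ)) =
      ∏ i ∈ Finset.range k, ∏ j ∈ Finset.Ico (i + 1) n, fac n (om k i) (om k j) i j := by
    rw [h1]
    symm
    apply prod_subset (Finset.range_subset_range.2 hk)
    intro i _ hi
    refine prod_eq_one fun j hj => ?_
    obtain ⟨ha, hb⟩ := Finset.mem_Ico.1 hj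
    have hi' : k ≤ i := by simpa using hi
    have ha' : (i : ℝ) + 1 ≤ j := by exact_mod_cast ha
    have hb' : (j : ℝ) + 1 ≤ n := by exact_mod_cast hb
    have e1 : om k i = 0 := if_neg (by omega)
    have e2 : om k j = 0 := if_neg (by omega)
    rw [e1, e2]
    unfold fac
    rw [div_eq_one_iff_eq]
    · ring
    · apply mul_ne_zero <;> linarith
  rw [h2]
  have h3 := prod_le_prod (s := Finset.range k)
    (f := fun i : ℕ => ∏ j ∈ Finset.Ico (i + 1) n, fac n (om k i) (om k j) i j)
    (g := fun i : ℕ => (2 * (2 * n - 2 * i - 1) * (n - i) : ℝ) / ((2 * n - k - i) * (k - i)))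
    (fun i hi => nn i (Finset.range_subset_range.2 hk hi))
    (fun i hi => row (Finset.mem_range.1 hi) hk)
  refine h3.trans (le_of_eq ?_)
  have hA := prodA n k hk
  have hB := prodB (2 * n - 2 * k) k
  have hC := prodB 0 k
  have e1 : 2 * n - 2 * k + k = 2 * n - k := by omega
  have e2 : ((2 * n - 2 * k : ℕ) : ℝ) + k = 2 * n - k := by
    rw [Nat.cast_sub (by omega)]; push_cast; ring
  rw [e1, e2] at hB
  simp only [Nat.cast_zero, zero_add, Nat.factorial_zero, Nat.cast_one, mul_one] at hC
  have hch := Nat.choose_mul_factorial_mul_factorial (show k ≤ 2 * n by omega)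
  have hch' : (((2 * n).choose k : ℕ) : ℝ) * (k.factorial : ℝ) * ((2 * n - k).factorial : ℝ) =
      ((2 * n).factorial : ℝ) := by exact_mod_cast hch
  have pf : ((2 * n - 2 * k).factorial : ℝ) ≠ 0 := by positivity
  have pk : (k.factorial : ℝ) ≠ 0 := by positivity
  have pB : (∏ i ∈ Finset.range k, ((2 * n : ℝ) - k - i)) ≠ 0 := by
    intro h
    rw [h, zero_mul] at hB
    exact absurd hB.symm (by positivity)
  rw [prod_div_distrib, prod_mul_distrib (f := fun i : ℕ => (2 * n : ℝ) - k - i), hC,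
    div_eq_iff (mul_ne_zero pB pk)]
  apply mul_right_cancel₀ pf
  rw [hA, ← hch', ← hB]
  ring

lemma log_ratio_scale {s s0 : ℝ} (h0 : 0 ≤ s) (h1 : s ≤ s0) (h2 : s0 < 1) :
    s0 * (Real.log (1 + s) - Real.log (1 - s)) ≤ s * (Real.log (1 + s0) - Real.log (1 - s0)) := by
  have H1 := (Real.hasSum_log_sub_log_of_abs_lt_one
    (show |s| < 1 by rw [abs_of_nonneg h0]; linarith)).mul_left s0
  have H2 := (Real.hasSum_log_sub_log_of_abs_lt_one
    (show |s0| < 1 by rw [abs_of_nonneg (h0.trans h1)]; linarith)).mul_left s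
  refine hasSum_le (fun k => ?_) H1 H2
  have hp : s ^ (2 * k) ≤ s0 ^ (2 * k) := pow_le_pow_left₀ h0 h1 _
  have hc : 0 ≤ s * s0 * (2 * (1 / (2 * (k : ℝ) + 1))) := by
    have := h0.trans h1
    positivity
  have := mul_le_mul_of_nonneg_left hp hc
  calc _ = s * s0 * (2 * (1 / (2 * (k : ℝ) + 1))) * s ^ (2 * k) := by ring
    _ ≤ _ := this
    _ = _ := by ring

lemma cube_le (n : ℕ) (hn : 5 ≤ n) : (2 * n) ^ 3 ≤ 2 ^ (2 * n) := by
  induction n, hn using Nat.le_induction with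
  | base => norm_num
  | succ n hn ih =>
    have : 2 ^ (2 * (n + 1)) = 4 * 2 ^ (2 * n) := by ring
    rw [this]
    nlinarith [Nat.mul_le_mul hn (Nat.mul_le_mul hn (le_refl n)), Nat.mul_le_mul hn (le_refl n)]

lemma step_ineq (n k : ℕ) (hn : 5 ≤ n) (hk1 : 1 ≤ k) (hk : k + 1 ≤ n) :
    Real.log (2 * n - k) - Real.log (k + 1) ≤
      (2 * n - 2 * k - 1) * (Real.log (2 * n) / (2 * n)) := by
  have hnR : (5 : ℝ) ≤ n := by exact_mod_cast hn
  have hk1R : (1 : ℝ) ≤ k := by exact_mod_cast hk1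
  have hkR : (k : ℝ) + 1 ≤ n := by exact_mod_cast hk
  have hp : (0 : ℝ) < 2 * n + 1 := by linarith
  have hs := @log_ratio_scale ((2 * n - 2 * k - 1) / (2 * n + 1)) ((2 * n - 3) / (2 * n + 1))
    (by apply div_nonneg <;> linarith) (by apply div_le_div_of_nonneg_right _ hp.le; linarith)
    (by rw [div_lt_one hp]; linarith)
  rw [← Real.log_div (by apply ne_of_gt; have : (0:ℝ) ≤ (2 * n - 2 * k - 1) / (2 * n + 1) := by { apply div_nonneg <;> linarith }
                         linarith)
        (by apply ne_of_gt; rw [sub_pos, div_lt_one hp]; linarith),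
      ← Real.log_div (by apply ne_of_gt; have : (0:ℝ) ≤ (2 * n - 3) / (2 * n + 1) := by { apply div_nonneg <;> linarith }
                         linarith)
        (by apply ne_of_gt; rw [sub_pos, div_lt_one hp]; linarith)] at hs
  have e1 : (1 + (2 * n - 2 * k - 1) / (2 * n + 1)) / (1 - (2 * n - 2 * k - 1) / (2 * (n : ℝ) + 1))
      = (2 * n - k) / (k + 1) := by
    have : (1 - (2 * n - 2 * k - 1) / (2 * (n : ℝ) + 1)) = (2 * (k + 1)) / (2 * n + 1) := by
      field_simp; ring
    rw [this]
    field_simp; ring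
  have e2 : (1 + (2 * n - 3) / (2 * n + 1)) / (1 - (2 * n - 3) / (2 * (n : ℝ) + 1))
      = (2 * n - 1) / 2 := by
    have : (1 - (2 * n - 3) / (2 * (n : ℝ) + 1)) = 4 / (2 * n + 1) := by
      field_simp; ring
    rw [this]
    field_simp; ring
  rw [e1, e2] at hs
  have hc : Real.log ((2 * n - 1) / 2) ≤ (2 * n - 3) * (Real.log (2 * n) / (2 * n)) := by
    have c1 : 3 * Real.log (2 * n) ≤ 2 * n * Real.log 2 := by
      have := cube_le n hn
      have h' : ((2 * n : ℝ)) ^ 3 ≤ 2 ^ (2 * n) := by exact_mod_cast this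
      have h'' := Real.log_le_log (by positivity) h'
      rw [Real.log_pow, Real.log_pow] at h''
      push_cast at h''
      exact h''
    have c2 : Real.log ((2 * n - 1) / 2) ≤ Real.log (2 * n) - Real.log 2 := by
      rw [← Real.log_div (by linarith) (by norm_num)]
      apply Real.log_le_log (by linarith)
      linarith
    have c3 : 3 * Real.log (2 * n) / (2 * n) ≤ Real.log 2 := by
      rw [div_le_iff₀ (by linarith)]; linarith
    have c4 : (2 * n - 3) * (Real.log (2 * n) / (2 * n)) = Real.log (2 * n) - 3 * Real.log (2 * n) / (2 * n) := by
      field_simp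
    linarith
  rw [← Real.log_div (by linarith) (by linarith)]
  have q : (0:ℝ) < (2 * n - 3) / (2 * n + 1) := by apply div_pos <;> linarith
  apply le_of_mul_le_mul_left _ q
  refine hs.trans ?_
  have := mul_le_mul_of_nonneg_left hc (show (0:ℝ) ≤ (2 * n - 2 * k - 1) / (2 * n + 1) by apply div_nonneg <;> linarith)
  refine this.trans (le_of_eq ?_)
  ring

lemma choose_bound (n k : ℕ) (hn : 5 ≤ n) (hk1 : 1 ≤ k) (hk : k ≤ n) :
    Real.log ((2 * n).choose k : ℝ) ≤
      (2 * n * k - k ^ 2 + 1) * (Real.log (2 * n) / (2 * n)) := by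
  induction k, hk1 using Nat.le_induction with
  | base =>
    have hnR : (5 : ℝ) ≤ n := by exact_mod_cast hn
    simp only [Nat.choose_one_right]
    push_cast
    apply le_of_eq
    field_simp
    ring
  | succ k hk1 ih =>
    have ih := ih (by omega)
    have hs := step_ineq n k hn hk1 hk
    have h := Nat.choose_succ_right_eq (2 * n) k
    have h' : (((2 * n).choose (k + 1) : ℕ) : ℝ) * (k + 1) = ((2 * n).choose k : ℝ) * (2 * n - k) := by
      have : ((2 * n - k : ℕ) : ℝ) = 2 * n - k := by
        rw [Nat.cast_sub (by omega)]; push_cast; ring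
      rw [← this]
      exact_mod_cast h
    have p1 : (0:ℝ) < ((2 * n).choose (k + 1) : ℝ) := by
      exact_mod_cast Nat.choose_pos (by omega)
    have p2 : (0:ℝ) < ((2 * n).choose k : ℝ) := by
      exact_mod_cast Nat.choose_pos (by omega)
    have hkR : (k : ℝ) + 1 ≤ n := by exact_mod_cast hk
    have p3 : (2 * n - k : ℝ) ≠ 0 := by
      have : (0:ℝ) ≤ k := by positivity
      linarith
    have h'' := congrArg Real.log h'
    rw [Real.log_mul p1.ne' (by positivity), Real.log_mul p2.ne' p3] at h''
    push_cast
    linear_combination ih + hs + h''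

lemma sum_om (n k : ℕ) (hk : k ≤ n) (f : ℕ → ℝ) :
    ∑ i : Fin n, om k i * f i = ∑ i ∈ Finset.range k, f i := by
  rw [← Finset.sum_range (fun i => om k i * f i)]
  symm
  rw [← Finset.sum_subset (Finset.range_subset_range.2 hk)]
  · refine sum_congr rfl fun i hi => ?_
    rw [om, if_pos (Finset.mem_range.1 hi), one_mul]
  · intro i _ hi
    rw [om, if_neg (by simpa using hi), zero_mul]

lemma BB_om (n k : ℕ) (hk : k ≤ n) :
    BB n (fun i => om k (i : ℕ)) = (2 * n * k - k ^ 2) / (2 * n) := by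
  have h : BB n (fun i => om k (i : ℕ)) = 1 / (2 * (n : ℝ)) *
      ∑ i ∈ Finset.range k, (1 + (2 * (n : ℝ) - 2 * ((i : ℝ) + 1))) := by
    unfold BB
    rw [← sum_om n k hk]
    congr 1
    refine sum_congr rfl fun i _ => ?_
    by_cases hi : (i : ℕ) < k <;> simp [om, hi]
  have h2 : ∀ m : ℕ, ∑ i ∈ Finset.range m, (1 + (2 * (n : ℝ) - 2 * ((i : ℝ) + 1))) = 2 * n * m - m ^ 2 := by
    intro m
    induction m with
    | zero => simp
    | succ m ih => rw [Finset.sum_range_succ, ih]; push_cast; ring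
  rw [h, h2]
  ring

lemma DD_om_bound (n k : ℕ) (hn : 5 ≤ n) (hk1 : 1 ≤ k) (hk : k ≤ n) :
    DD n (fun i => om k (i : ℕ)) ≤ (2 * (n : ℝ)) ^ (BB n (fun i => om k (i : ℕ)) + 1 / (2 * n)) := by
  refine (DD_om_le n k hk).trans ?_
  have hnR : (5 : ℝ) ≤ n := by exact_mod_cast hn
  have p1 : (0:ℝ) < ((2 * n).choose k : ℝ) := by
    exact_mod_cast Nat.choose_pos (by omega)
  rw [← Real.log_le_log_iff p1 (by positivity), Real.log_rpow (by positivity), BB_om n k hk]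
  refine (choose_bound n k hn hk1 hk).trans (le_of_eq ?_)
  ring

lemma DD_const (n : ℕ) (lam : Fin n → ℝ) (h : ∀ i, lam i = 0) : DD n lam = 1 := by
  unfold DD
  refine prod_eq_one fun i _ => prod_eq_one fun j hj => ?_
  obtain ⟨h1, h2⟩ := fin_cast_facts (Finset.mem_Ioi.1 hj)
  rw [h, h]
  unfold fac
  rw [div_eq_one_iff_eq]
  · ring
  · apply mul_ne_zero <;> linarith

lemma BB_const (n : ℕ) (lam : Fin n → ℝ) (h : ∀ i, lam i = 0) : BB n lam = 0 := by
  unfold BB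
  simp [h]

lemma main_int (n : ℕ) (hn : 5 ≤ n) (M : ℕ) : ∀ (m : Fin n → ℕ), Antitone m →
    m ⟨0, by omega⟩ = M →
    DD n (fun i => (m i : ℝ)) ≤
      (2 * (n : ℝ)) ^ (BB n (fun i => (m i : ℝ)) + (2 * M - M ^ 2) / (2 * n)) := by
  have hnR : (5 : ℝ) ≤ n := by exact_mod_cast hn
  induction M with
  | zero =>
    intro m hm h0
    have hz : ∀ i, ((m i : ℕ) : ℝ) = 0 := by
      intro i
      have : m i ≤ m ⟨0, by omega⟩ := hm (by exact Nat.zero_le _)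
      rw [h0] at this
      exact_mod_cast Nat.le_zero.1 this
    rw [DD_const n _ hz, BB_const n _ hz]
    simp
  | succ M ih =>
    intro m hm h0
    classical
    have hex : ∃ k, ∀ i : Fin n, k ≤ (i : ℕ) → m i = 0 :=
      ⟨n, fun i hi => absurd i.2 (by omega)⟩
    obtain ⟨k, hk, hmin⟩ : ∃ k, (∀ i : Fin n, k ≤ (i : ℕ) → m i = 0) ∧
        ∀ l < k, ¬ ∀ i : Fin n, l ≤ (i : ℕ) → m i = 0 :=
      ⟨Nat.find hex, Nat.find_spec hex, fun l hl => Nat.find_min hex hl⟩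
    have hkn : k ≤ n := by
      by_contra hlt
      exact hmin n (by omega) fun i hi => absurd i.2 (by omega)
    have hpos : ∀ i : Fin n, (i : ℕ) < k → 1 ≤ m i := by
      intro i hi
      have := hmin i hi
      push Not at this
      obtain ⟨j, hj, hj0⟩ := this
      have : m j ≤ m i := hm (by exact hj)
      omega
    have hk1 : 1 ≤ k := by
      by_contra hlt
      have := hk ⟨0, by omega⟩ (by simp; omega)
      omega
    have hmu : Antitone (fun i => m i - 1) := fun i j hij => Nat.sub_le_sub_right (hm hij) 1
    have hI := ih (fun i => m i - 1) hmu (by simp [h0])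
    have hO := DD_om_bound n k hn hk1 hkn
    have hdec : (fun i => (m i : ℝ)) = fun i => ((m i - 1 : ℕ) : ℝ) + om k (i : ℕ) := by
      funext i
      unfold om
      split_ifs with h
      · have := hpos i h
        rw [Nat.cast_sub this]; simp
      · rw [hk i (by omega)]; simp
    have hO1 : Antitone (fun i : Fin n => om k (i : ℕ)) := fun i j hij => om_anti k hij
    have hmuR : Antitone (fun i => ((m i - 1 : ℕ) : ℝ)) := fun i j hij =>
      Nat.cast_le.2 (hmu hij)
    have hD := DD_add hmuR (fun i => Nat.cast_nonneg _) hO1 (fun i => om_nonneg _ _)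
    have hB := BB_add (fun i => ((m i - 1 : ℕ) : ℝ)) (fun i : Fin n => om k (i : ℕ))
    rw [← hdec] at hD hB
    refine hD.trans ((mul_le_mul hI hO (DD_nonneg hO1 fun i => om_nonneg _ _) (by positivity)).trans ?_)
    rw [← Real.rpow_add (by positivity)]
    apply Real.rpow_le_rpow_of_exponent_le (by linarith)
    have hS : (M : ℝ) ≤ ∑ i : Fin n, ((m i - 1 : ℕ) : ℝ) * om k (i : ℕ) := by
      have := Finset.single_le_sum (s := Finset.univ)
        (f := fun i : Fin n => ((m i - 1 : ℕ) : ℝ) * om k (i : ℕ))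
        (fun i _ => mul_nonneg (Nat.cast_nonneg _) (om_nonneg _ _))
        (Finset.mem_univ (⟨0, by omega⟩ : Fin n))
      refine le_trans (le_of_eq ?_) this
      simp only [h0]
      rw [om, if_pos (by omega)]
      simp
    rw [hB]
    have hS' : 1 / (n : ℝ) * M ≤ 1 / n * ∑ i : Fin n, ((m i - 1 : ℕ) : ℝ) * om k (i : ℕ) := by
      gcongr
    have e : (2 * ((M + 1 : ℕ) : ℝ) - ((M + 1 : ℕ) : ℝ) ^ 2) / (2 * n)
        = (2 * M - M ^ 2) / (2 * n) + 1 / (2 * n) - 1 / (n : ℝ) * M := by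
      push_cast
      field_simp
      ring
    rw [e]
    linarith

lemma ten_root (n : ℕ) (hn : 5 ≤ n) : (2 * (n : ℝ)) ^ ((1 : ℝ) / (2 * n)) ≤ 4 / 3 := by
  have hnR : (5 : ℝ) ≤ n := by exact_mod_cast hn
  have h : ∀ n : ℕ, 5 ≤ n → (2 * (n : ℝ)) ≤ (4 / 3) ^ (2 * n) := by
    intro n hn
    induction n, hn using Nat.le_induction with
    | base => norm_num
    | succ n hn ih =>
      have hnR : (5 : ℝ) ≤ n := by exact_mod_cast hn
      have : (4 / 3 : ℝ) ^ (2 * (n + 1)) = 16 / 9 * (4 / 3) ^ (2 * n) := by ring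
      rw [this]
      push_cast
      linarith
  have h1 := h n hn
  calc _ ≤ (((4 / 3 : ℝ)) ^ (2 * n)) ^ ((1 : ℝ) / (2 * n)) := by
        apply Real.rpow_le_rpow (by positivity) h1 (by positivity)
    _ = 4 / 3 := by
        rw [← Real.rpow_natCast, ← Real.rpow_mul (by norm_num)]
        push_cast
        rw [mul_one_div_cancel (by positivity), Real.rpow_one]

lemma main_int' (n : ℕ) (hn : 5 ≤ n) (m : Fin n → ℕ) (hm : Antitone m) :
    DD n (fun i => (m i : ℝ)) ≤ 4 / 3 * (2 * (n : ℝ)) ^ (BB n (fun i => (m i : ℝ))) := by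
  have hnR : (5 : ℝ) ≤ n := by exact_mod_cast hn
  refine (main_int n hn _ m hm rfl).trans ?_
  rw [Real.rpow_add (by positivity), mul_comm]
  gcongr
  refine le_trans ?_ (ten_root n hn)
  apply Real.rpow_le_rpow_of_exponent_le (by linarith)
  gcongr
  nlinarith [sq_nonneg ((m ⟨0, by omega⟩ : ℝ) - 1)]

lemma DD_half (n : ℕ) (hn : 5 ≤ n) : DD n (fun _ => 1 / 2) ≤ 2 ^ (n - 1) := by
  have hrow : ∀ i : ℕ, i < n → ∀ m, i + 1 ≤ m → m ≤ n →
      (∏ j ∈ Finset.Ico (i + 1) m, fac n (1 / 2) (1 / 2) i j) * (2 * n - i - m - 1) =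
        2 * n - 2 * (i : ℝ) - 2 := by
    intro i hi m him hmn
    induction m, him using Nat.le_induction with
    | base => push_cast; simp; ring
    | succ m him ih =>
      rw [Finset.prod_Ico_succ_top him, ← ih (by omega), mul_assoc]
      congr 1
      have h1 : ((i : ℝ) + 1) ≤ m := by exact_mod_cast him
      have h2 : ((m : ℝ) + 1) ≤ n := by exact_mod_cast hmn
      have h3 : (m : ℝ) - i ≠ 0 := by linarith
      have h4 : 2 * (n : ℝ) - (i + 1) - (m + 1) ≠ 0 := by linarith
      unfold fac
      push_cast
      field_simp
      ring
  have h1 : DD n (fun _ => 1 / 2) =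
      ∏ i ∈ Finset.range n, ∏ j ∈ Finset.Ico (i + 1) n, fac n (1 / 2) (1 / 2) i j := by
    unfold DD
    rw [Finset.prod_range]
    exact prod_congr rfl fun i _ => Ioi_prod i (fun j => fac n (1 / 2) (1 / 2) (i : ℕ) (j : ℕ))
  obtain ⟨d, rfl⟩ : ∃ d, n = d + 1 := ⟨n - 1, by omega⟩
  rw [h1, Finset.prod_range_succ]
  have h2 : ∀ i ∈ Finset.range d, ∏ j ∈ Finset.Ico (i + 1) (d + 1), fac (d + 1) (1 / 2) (1 / 2) i j = 2 := by
    intro i hi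
    have hi' := Finset.mem_range.1 hi
    have := hrow i (by omega) (d + 1) (by omega) le_rfl
    have hiR : (i : ℝ) + 1 ≤ d := by exact_mod_cast hi'
    push_cast at this
    have h3 : (d : ℝ) - i ≠ 0 := by linarith
    apply mul_right_cancel₀ h3
    linear_combination this
  rw [prod_congr rfl h2]
  simp

lemma BB_half (n : ℕ) (hn : 5 ≤ n) : BB n (fun _ => 1 / 2) = (2 * n - 1) / 8 := by
  have hnR : (5 : ℝ) ≤ n := by exact_mod_cast hn
  have h2 : ∀ m : ℕ, ∑ i ∈ Finset.range m, ((1 / 2 : ℝ) ^ 2 + (2 * (n : ℝ) - 2 * ((i : ℝ) + 1)) * (1 / 2))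
      = (m : ℝ) / 4 + n * m - m * (m + 1) / 2 := by
    intro m
    induction m with
    | zero => simp
    | succ m ih => rw [Finset.sum_range_succ, ih]; push_cast; ring
  unfold BB
  rw [← Finset.sum_range (fun i : ℕ => ((1 / 2 : ℝ) ^ 2 + (2 * (n : ℝ) - 2 * ((i : ℝ) + 1)) * (1 / 2))), h2]
  field_simp
  ring

lemma half_bound (n : ℕ) (hn : 5 ≤ n) :
    (2 : ℝ) ^ (n - 1) ≤ 2 * (2 * (n : ℝ)) ^ ((2 * (n : ℝ) - 1) / 8) := by
  have key : 2 ^ (8 * n) ≤ 2 ^ 16 * (2 * n) ^ (2 * n - 1) := by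
    rcases Nat.lt_or_ge n 8 with h | h
    · interval_cases n <;> norm_num
    · calc 2 ^ (8 * n) ≤ 2 ^ (16 + 4 * (2 * n - 1)) := Nat.pow_le_pow_right (by norm_num) (by omega)
        _ = 2 ^ 16 * 16 ^ (2 * n - 1) := by rw [pow_add, pow_mul]; norm_num
        _ ≤ _ := by gcongr; omega
  have hnR : (5 : ℝ) ≤ n := by exact_mod_cast hn
  have keyR : (2 : ℝ) ^ (8 * n) ≤ 2 ^ 16 * (2 * n) ^ (2 * n - 1) := by exact_mod_cast key
  apply le_of_pow_le_pow_left₀ (n := 8) (by norm_num) (by positivity)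
  rw [mul_pow, ← Real.rpow_natCast (_ ^ (_ : ℝ)) 8, ← Real.rpow_mul (by positivity)]
  have e : (2 * (n : ℝ) - 1) / 8 * ((8 : ℕ) : ℝ) = ((2 * n - 1 : ℕ) : ℝ) := by
    rw [Nat.cast_sub (by omega)]; push_cast; ring
  rw [e, Real.rpow_natCast, ← pow_mul]
  have e2 : (2 : ℝ) ^ (8 * n) = 2 ^ 8 * 2 ^ ((n - 1) * 8) := by
    rw [← pow_add]; congr 1; omega
  rw [e2] at keyR
  have : (0:ℝ) ≤ (2 * n) ^ (2 * n - 1) := by positivity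
  linarith

lemma main_half (n : ℕ) (hn : 5 ≤ n) (m : Fin n → ℕ) (hm : Antitone m) :
    DD n (fun i => (m i : ℝ) + 1 / 2) ≤
      48 / 15 * (2 * (n : ℝ)) ^ (BB n (fun i => (m i : ℝ) + 1 / 2)) := by
  have hnR : (5 : ℝ) ≤ n := by exact_mod_cast hn
  have hmR : Antitone (fun i => (m i : ℝ)) := fun i j hij => Nat.cast_le.2 (hm hij)
  have hc : Antitone (fun _ : Fin n => (1 / 2 : ℝ)) := fun _ _ _ => le_rfl
  have hD := DD_add hmR (fun i => Nat.cast_nonneg _) hc (fun _ => by norm_num)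
  have hB := BB_add (fun i => (m i : ℝ)) (fun _ : Fin n => (1 / 2 : ℝ))
  have h1 := main_int' n hn m hm
  have h2 := (DD_half n hn).trans (half_bound n hn)
  rw [← BB_half n hn] at h2
  have h3 := hD.trans (mul_le_mul h1 h2 (DD_nonneg hc fun _ => by norm_num) (by positivity))
  have h4 : (2 * (n : ℝ)) ^ (BB n (fun i => (m i : ℝ))) * (2 * (n : ℝ)) ^ (BB n (fun _ => 1 / 2))
      ≤ (2 * (n : ℝ)) ^ (BB n (fun i => (m i : ℝ) + 1 / 2)) := by
    rw [← Real.rpow_add (by positivity), hB]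
    apply Real.rpow_le_rpow_of_exponent_le (by linarith)
    have : 0 ≤ 1 / (n : ℝ) * ∑ i : Fin n, (m i : ℝ) * (1 / 2) := by positivity
    linarith
  have h5 : 0 ≤ (2 * (n : ℝ)) ^ (BB n (fun i => (m i : ℝ) + 1 / 2)) := by positivity
  nlinarith [h3, h4, h5]



/-- For `n ≥ 5`: for any integer partition `λ` of length `n`, the `SO(2n)` Weyl dimension
`D^λ = ∏_{1≤i<j≤n} ((λ_i-λ_j+j-i)(λ_i+λ_j+2n-i-j))/((j-i)(2n-i-j))` satisfies
`D^λ ≤ (4/3)·(2n)^{B_n(λ)}`, and for any half-partition `λ` of length `n` one has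
`D^λ ≤ (48/15)·(2n)^{B_n(λ)}`, where `B_n(λ) = (1/(2n))·∑_{i=1}^n (λ_i² + (2n-2i)λ_i)`. -/
theorem statement8 (n : ℕ) (hn : 5 ≤ n) (lam : Fin n → ℝ) (hanti : Antitone lam) :
    let D : ℝ :=
      ∏ i : Fin n, ∏ j ∈ Finset.Ioi i,
        ((lam i - lam j + ((j : ℕ) : ℝ) - ((i : ℕ) : ℝ)) *
            (lam i + lam j +
              (2 * (n : ℝ) - (((i : ℕ) : ℝ) + 1) - (((j : ℕ) : ℝ) + 1)))) /
          ((((j : ℕ) : ℝ) - ((i : ℕ) : ℝ)) *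
            (2 * (n : ℝ) - (((i : ℕ) : ℝ) + 1) - (((j : ℕ) : ℝ) + 1)))
    let B : ℝ :=
      1 / (2 * (n : ℝ)) *
        ∑ i : Fin n, (lam i ^ 2 + (2 * (n : ℝ) - 2 * (((i : ℕ) : ℝ) + 1)) * lam i)
    ((∀ i, ∃ m : ℕ, lam i = m) → D ≤ 4 / 3 * (2 * (n : ℝ)) ^ B) ∧
      ((∀ i, ∃ m : ℕ, lam i = (m : ℝ) + 1 / 2) → D ≤ 48 / 15 * (2 * (n : ℝ)) ^ B) := by
  intro D B
  have hDD : D = DD n lam := rfl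
  have hBB : B = BB n lam := rfl
  rw [hDD, hBB]
  constructor
  · intro h
    choose m hm using h
    have hl : lam = fun i => (m i : ℝ) := funext hm
    have ha : Antitone m := fun i j hij => by
      have := hanti hij
      rw [hm, hm] at this
      exact_mod_cast this
    rw [hl]
    exact main_int' n hn m ha
  · intro h
    choose m hm using h
    have hl : lam = fun i => (m i : ℝ) + 1 / 2 := funext hm
    have ha : Antitone m := fun i j hij => by
      have := hanti hij
      rw [hm, hm] at this
      have h2 : ((m j : ℕ) : ℝ) ≤ m i := by linarith
      exact_mod_cast h2
    rw [hl]
    exact main_half n hn m ha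
end
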